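/- Let k ≥ 1, let A_1, …, A_k be pairwise disjoint bounded rectangles in [0,1]^d, let z ∈ ℝ, let R_1, …, R_k ⊆ (z,+∞] each be a finite union of disjoint intervals of the form (x,y] with z ≤ x < y ≤ +∞, and fix ε > 0. Set I_j := nA_j ∩ V_N, I := I_1 ∪ ⋯ ∪ I_k, and for α ∈ I_j let X_α := 1{(φ_α − b_N)/a_N ∈ R_j}, p_α := P(X_α = 1), and B_α := {β ∈ I : ‖β−α‖ ≤ (log N)^{2+2ε}}. Then Σ_{α∈I} E[ | E[X_α | σ(X_β : β ∈ I∖B_α)] − p_α | ] → 0 as n → ∞. -/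

import Mathlib

open MeasureTheory ProbabilityTheory Real Filter Set

/-- `ℤ^d` as functions `Fin d → ℤ`. -/
abbrev Zd (d : ℕ) := Fin d → ℤ

/-- One step of the simple random walk: move from `a` by `±1` in coordinate `i`. -/
def rwStep (d : ℕ) (i : Fin d) (s : Bool) (a : Zd d) : Zd d :=
  Function.update a i (a i + if s then 1 else -1)

/-- `m`-step transition probability of the simple random walk on `ℤ^d`. -/
noncomputable def rwP (d : ℕ) : ℕ → Zd d → Zd d → ℝ
  | 0, a, b => if a = b then 1 else 0
  | (m+1), a, b => (1 / (2 * d)) * ∑ i : Fin d, ∑ s : Bool, rwP d m (rwStep d i s a) b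

/-- The Green's function `g(a,b)` of the simple random walk on `ℤ^d`. -/
noncomputable def green (d : ℕ) (a b : Zd d) : ℝ := ∑' m, rwP d m a b

open Classical in
/-- Probability that the walk started at `a` is at `b` at time `m`, having stayed in `Λ`
at all times `0,…,m`. -/
noncomputable def rwPIn (d : ℕ) (Λ : Set (Zd d)) : ℕ → Zd d → Zd d → ℝ
  | 0, a, b => if a = b ∧ a ∈ Λ then 1 else 0
  | (m+1), a, b =>
      if a ∈ Λ then (1 / (2 * d)) * ∑ i : Fin d, ∑ s : Bool, rwPIn d Λ m (rwStep d i s a) b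
      else 0

/-- Dirichlet Green's function `g_Λ(a,b)` (killed upon exiting `Λ`). -/
noncomputable def greenIn (d : ℕ) (Λ : Set (Zd d)) (a b : Zd d) : ℝ := ∑' m, rwPIn d Λ m a b

open Classical in
/-- Probability that the walk started at `a` first hits `F` at time `m`, at the point `b`. -/
noncomputable def hitP (d : ℕ) (F : Set (Zd d)) : ℕ → Zd d → Zd d → ℝ
  | 0, a, b => if a = b ∧ b ∈ F then 1 else 0
  | (m+1), a, b =>
      if a ∈ F then 0
      else (1 / (2 * d)) * ∑ i : Fin d, ∑ s : Bool, hitP d F m (rwStep d i s a) b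

open Classical in
/-- Probability that the walk started at `a` first hits `F` at time `m`, at the point `b`,
before exiting `Λ`. -/
noncomputable def hitPIn (d : ℕ) (Λ F : Set (Zd d)) : ℕ → Zd d → Zd d → ℝ
  | 0, a, b => if a = b ∧ b ∈ F ∧ b ∈ Λ then 1 else 0
  | (m+1), a, b =>
      if a ∈ Λ ∧ a ∉ F then
        (1 / (2 * d)) * ∑ i : Fin d, ∑ s : Bool, hitPIn d Λ F m (rwStep d i s a) b
      else 0

/-- `ℙ_a(H_F < ∞, S_{H_F} = b)`, the harmonic measure of `F` seen from `a`. -/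
noncomputable def hitMeas (d : ℕ) (F : Set (Zd d)) (a b : Zd d) : ℝ := ∑' m, hitP d F m a b

/-- `ℙ_a(H_F < H_{ℤ^d∖Λ}, S_{H_F} = b)`. -/
noncomputable def hitMeasIn (d : ℕ) (Λ F : Set (Zd d)) (a b : Zd d) : ℝ :=
  ∑' m, hitPIn d Λ F m a b

/-- `(φ_a)_{a∈ℤ^d}` is a centered Gaussian field with covariance `G`: every finite linear
combination is a centered Gaussian with the prescribed variance. -/
def IsGaussianField {Ω : Type*} [MeasurableSpace Ω] (P : Measure Ω) (d : ℕ)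
    (G : Zd d → Zd d → ℝ) (φ : Zd d → Ω → ℝ) : Prop :=
  (∀ a, Measurable (φ a)) ∧
    ∀ c : Zd d →₀ ℝ,
      Measure.map (fun ω => ∑ a ∈ c.support, c a * φ a ω) P =
        gaussianReal 0
          (Real.toNNReal (∑ a ∈ c.support, ∑ b ∈ c.support, c a * c b * G a b))

/-- The centering sequence `b_N` (here `g0 = g(0)` is the variance of the field). -/
noncomputable def bN (g0 : ℝ) (N : ℕ) : ℝ :=
  Real.sqrt g0 * (Real.sqrt (2 * Real.log N) -
    (Real.log (Real.log N) + Real.log (4 * π)) / (2 * Real.sqrt (2 * Real.log N)))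

/-- The scaling sequence `a_N = g(0)/b_N`. -/
noncomputable def aN (g0 : ℝ) (N : ℕ) : ℝ := g0 / bN g0 N

/-- `u_N(z) = a_N z + b_N`. -/
noncomputable def uN (g0 : ℝ) (N : ℕ) (z : ℝ) : ℝ := aN g0 N * z + bN g0 N

/-- The box `V_N = ([0,n-1]^d) ∩ ℤ^d`, `N = n^d`. -/
noncomputable def VN (d n : ℕ) : Finset (Zd d) :=
  Fintype.piFinset fun _ => Finset.Icc (0 : ℤ) ((n : ℤ) - 1)

/-- The `ℓ∞` distance between two points of `ℤ^d`, as a real number. -/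
noncomputable def distInf (d : ℕ) (a b : Zd d) : ℝ :=
  ((Finset.univ.sup fun i => (a i - b i).natAbs : ℕ) : ℝ)

open Classical in
/-- The bulk `V_N^δ` of the box `V_N`. -/
noncomputable def bulk (d n : ℕ) (δ : ℝ) : Finset (Zd d) :=
  (VN d n).filter fun a => ∀ b : Zd d, b ∉ VN d n → δ * n < distInf d a b

/-- The rectangle `∏_i ([0,1] ∩ (lo i, hi i])` in `[0,1]^d`. -/
def rect (d : ℕ) (lo hi : Fin d → ℝ) : Set (Fin d → ℝ) :=
  {t | ∀ i, t i ∈ Set.Icc (0 : ℝ) 1 ∩ Set.Ioc (lo i) (hi i)}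

open Classical in
/-- `nA ∩ V_N = {α ∈ V_N : α/n ∈ A}` for the rectangle `A = rect d lo hi`. -/
noncomputable def rectIdx (d n : ℕ) (lo hi : Fin d → ℝ) : Finset (Zd d) :=
  (VN d n).filter fun a => (fun i => (a i : ℝ) / n) ∈ rect d lo hi

/-- `e^{-y}` for `y ∈ (-∞,+∞]`, with the convention `e^{-∞} = 0`. -/
noncomputable def expE (y : EReal) : ℝ := if y = ⊤ then 0 else Real.exp (-y.toReal)

/-- `u_N` extended to `(-∞,+∞]` by `u_N(+∞) = +∞`. -/
noncomputable def uNE (g0 : ℝ) (N : ℕ) (y : EReal) : EReal :=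
  if y = ⊤ then ⊤ else ((uN g0 N y.toReal : ℝ) : EReal)

/-- `ω(R) = ∫_R e^{-z} dz` for `R ⊆ (-∞,+∞]`. -/
noncomputable def omegaMeas (R : Set EReal) : ℝ :=
  ∫ t in {t : ℝ | (t : EReal) ∈ R}, Real.exp (-t)

/-- `R ⊆ (-∞,+∞]` is a finite union of disjoint intervals `(x,y]` with
`-∞ < x < y ≤ +∞`. -/
def IsFiniteUnionIoc (R : Set EReal) : Prop :=
  ∃ (m : ℕ) (w : Fin m → ℝ) (r : Fin m → EReal),
    (∀ l, (w l : EReal) < r l) ∧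
    (Pairwise fun l l' =>
      Disjoint (Set.Ioc (w l : EReal) (r l)) (Set.Ioc (w l' : EReal) (r l'))) ∧
    R = ⋃ l, Set.Ioc ((w l : ℝ) : EReal) (r l)


/-- `R ⊆ (z,+∞]` is a finite union of disjoint intervals `(x,y]` with `z ≤ x < y ≤ +∞`. -/
def IsFiniteUnionIocFrom (z : ℝ) (R : Set EReal) : Prop :=
  ∃ (m : ℕ) (w : Fin m → ℝ) (r : Fin m → EReal),
    (∀ l, z ≤ w l) ∧ (∀ l, (w l : EReal) < r l) ∧
    (Pairwise fun l l' =>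
      Disjoint (Set.Ioc (w l : EReal) (r l)) (Set.Ioc (w l' : EReal) (r l'))) ∧
    R = ⋃ l, Set.Ioc ((w l : ℝ) : EReal) (r l)

/-- The full index set `I = I_1 ∪ ⋯ ∪ I_k` with `I_j = nA_j ∩ V_N`. -/
noncomputable def stIdx (d n k : ℕ) (lo hi : Fin k → Fin d → ℝ) : Finset (Zd d) :=
  Finset.univ.biUnion fun j => rectIdx d n (lo j) (hi j)

open Classical in
/-- The Bernoulli variable `X_α = 1{(φ_α - b_N)/a_N ∈ R_j}` for `α ∈ I_j`. -/
noncomputable def stX (d n k : ℕ) (lo hi : Fin k → Fin d → ℝ) (R : Fin k → Set EReal)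
    {Ω : Type*} [MeasurableSpace Ω] (φ : Zd d → Ω → ℝ) (a : Zd d) (ω : Ω) : ℝ :=
  if ∃ j, a ∈ rectIdx d n (lo j) (hi j) ∧
      (((φ a ω - bN (green d 0 0) (n ^ d)) / aN (green d 0 0) (n ^ d) : ℝ) : EReal) ∈ R j
  then 1 else 0

open Classical in
/-- The neighbourhood of dependence `B_α = {β ∈ I : ‖β-α‖ ≤ (log N)^{2+2ε}}`. -/
noncomputable def stB (d n k : ℕ) (ε : ℝ) (lo hi : Fin k → Fin d → ℝ) (a : Zd d) :
    Finset (Zd d) :=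
  (stIdx d n k lo hi).filter fun b =>
    distInf d b a ≤ (Real.log ((n ^ d : ℕ) : ℝ)) ^ (2 + 2 * ε)

/-- The σ-algebra `σ(X_β : β ∈ I ∖ B_α)`. -/
noncomputable def stSigma (d n k : ℕ) (ε : ℝ) (lo hi : Fin k → Fin d → ℝ)
    (R : Fin k → Set EReal) {Ω : Type*} [MeasurableSpace Ω] (φ : Zd d → Ω → ℝ)
    (a : Zd d) : MeasurableSpace Ω :=
  ⨆ b ∈ stIdx d n k lo hi \ stB d n k ε lo hi a,
    MeasurableSpace.comap (stX d n k lo hi R φ b) inferInstance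

/-! ### Fourier representation and heat kernel bound for the simple random walk -/

/-- Lebesgue measure on the torus `(-π, π]^d`. -/
noncomputable def torusMeasure (d : ℕ) : Measure (Fin d → ℝ) :=
  Measure.pi fun _ => volume.restrict (Set.Ioc (-π) π)

instance (d : ℕ) : IsFiniteMeasure (torusMeasure d) := by
  unfold torusMeasure; infer_instance

/-- The characteristic function of one step of the simple random walk. -/
noncomputable def stepChar (d : ℕ) (θ : Fin d → ℝ) : ℝ := (1 / d) * ∑ i, Real.cos (θ i)

lemma continuous_stepChar (d : ℕ) : Continuous (stepChar d) := by
  unfold stepChar; fun_prop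

lemma abs_stepChar_le (d : ℕ) (θ : Fin d → ℝ) : |stepChar d θ| ≤ (1 / d) * ∑ i, |Real.cos (θ i)| := by
  unfold stepChar
  rw [abs_mul, abs_of_nonneg (by positivity : (0 : ℝ) ≤ 1 / d)]
  gcongr
  exact Finset.abs_sum_le_sum_abs _ _

lemma abs_stepChar_le_one (d : ℕ) (θ : Fin d → ℝ) : |stepChar d θ| ≤ 1 := by
  refine (abs_stepChar_le d θ).trans ?_
  have h : ∑ i : Fin d, |Real.cos (θ i)| ≤ d := by
    calc _ ≤ ∑ i : Fin d, (1 : ℝ) := Finset.sum_le_sum fun i _ => Real.abs_cos_le_one _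
      _ = d := by simp
  rcases Nat.eq_zero_or_pos d with rfl | hd
  · simp
  · have : (0 : ℝ) < d := by exact_mod_cast hd
    rw [one_div, inv_mul_le_iff₀ this]
    linarith

lemma integral_exp_int_mul (n : ℤ) :
    ∫ t in Set.Ioc (-π) π, Complex.exp (Complex.I * n * t) = if n = 0 then (2 * π : ℂ) else 0 := by
  rw [← intervalIntegral.integral_of_le (by linarith [Real.pi_pos])]
  split_ifs with h
  · simp [h]; ring
  · rw [integral_exp_mul_complex (by simp [h])]
    have : Complex.exp (Complex.I * n * (π : ℝ)) = Complex.exp (Complex.I * n * ((-π : ℝ) : ℂ)) := by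
      rw [Complex.exp_eq_exp_iff_exists_int]
      exact ⟨n, by push_cast; ring⟩
    rw [this, sub_self, zero_div]

lemma integral_cos_torus (d : ℕ) (x : Fin d → ℤ) :
    ∫ θ, Real.cos (∑ j, (x j : ℝ) * θ j) ∂(torusMeasure d) = if x = 0 then (2 * π) ^ d else 0 := by
  have h1 : ∫ θ, ∏ j, Complex.exp (Complex.I * x j * (θ j : ℝ)) ∂(torusMeasure d)
      = if x = 0 then ((2 * π : ℝ) : ℂ) ^ d else 0 := by
    unfold torusMeasure
    rw [integral_fintype_prod_eq_prod (𝕜 := ℂ)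
      (f := fun j (t : ℝ) => Complex.exp (Complex.I * x j * t))]
    simp_rw [integral_exp_int_mul]
    split_ifs with h
    · subst h; simp
    · obtain ⟨j, hj⟩ := Function.ne_iff.1 h
      exact Finset.prod_eq_zero (Finset.mem_univ j) (by simpa using hj)
  have h2 : ∀ θ : Fin d → ℝ, ∏ j, Complex.exp (Complex.I * x j * (θ j : ℝ))
      = Complex.exp ((∑ j, (x j : ℝ) * θ j : ℝ) * Complex.I) := by
    intro θ
    rw [← Complex.exp_sum]
    congr 1
    push_cast
    rw [Finset.sum_mul]
    exact Finset.sum_congr rfl fun j _ => by ring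
  simp_rw [h2] at h1
  have h3 := congrArg Complex.re h1
  have hint : Integrable (fun θ : Fin d → ℝ =>
      Complex.exp ((∑ j, (x j : ℝ) * θ j : ℝ) * Complex.I)) (torusMeasure d) := by
    refine Integrable.of_bound (C := 1) ?_ ?_
    · exact Continuous.aestronglyMeasurable (by fun_prop)
    · exact ae_of_all _ fun θ => by rw [Complex.norm_exp_ofReal_mul_I]
  have h4 := integral_re hint
  simp only [RCLike.re_to_complex] at h4
  rw [← h4] at h3
  simp_rw [Complex.exp_ofReal_mul_I_re] at h3
  rw [h3]
  split_ifs
  · rw [← Complex.ofReal_pow, Complex.ofReal_re]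
  · simp

lemma integrable_stepChar_pow_mul_cos (d m : ℕ) (f : (Fin d → ℝ) → ℝ) (hf : Continuous f) :
    Integrable (fun θ => stepChar d θ ^ m * Real.cos (f θ)) (torusMeasure d) := by
  refine Integrable.of_bound (C := 1) ?_ ?_
  · have := continuous_stepChar d
    exact Continuous.aestronglyMeasurable (by fun_prop)
  · refine ae_of_all _ fun θ => ?_
    rw [Real.norm_eq_abs, abs_mul, abs_pow]
    exact mul_le_one₀ (pow_le_one₀ (abs_nonneg _) (abs_stepChar_le_one d θ)) (abs_nonneg _)
      (Real.abs_cos_le_one _)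

lemma sum_rwStep_sub_mul (d : ℕ) (i : Fin d) (s : Bool) (a b : Zd d) (θ : Fin d → ℝ) :
    ∑ j, ((rwStep d i s a j - b j : ℤ) : ℝ) * θ j
      = ∑ j, ((a j - b j : ℤ) : ℝ) * θ j + (if s then θ i else - θ i) := by
  have h : ∀ j, ((rwStep d i s a j - b j : ℤ) : ℝ) * θ j
      = ((a j - b j : ℤ) : ℝ) * θ j + (if j = i then (if s then θ i else -θ i) else 0) := by
    intro j
    unfold rwStep
    by_cases h : j = i
    · subst h
      cases s <;> simp <;> ring
    · simp [h]
  rw [Finset.sum_congr rfl fun j _ => h j, Finset.sum_add_distrib]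
  simp

lemma rwP_eq_integral (d m : ℕ) (a b : Zd d) :
    rwP d m a b = ((2 * π) ^ d)⁻¹ *
      ∫ θ, stepChar d θ ^ m * Real.cos (∑ j, ((a j - b j : ℤ) : ℝ) * θ j) ∂(torusMeasure d) := by
  induction m generalizing a with
  | zero =>
    have := integral_cos_torus d (fun j => a j - b j)
    simp only [pow_zero, one_mul, this]
    have h : (fun j => a j - b j) = 0 ↔ a = b := by
      rw [← sub_eq_zero (a := a)]; rfl
    simp only [h, rwP]
    split_ifs
    · rw [inv_mul_cancel₀ (by positivity)]
    · simp
  | succ m ih =>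
    simp only [rwP, ih]
    simp_rw [← Finset.mul_sum]
    rw [← mul_assoc, mul_comm (1 / (2 * (d : ℝ))), mul_assoc]
    congr 1
    have hI : ∀ i s, Integrable (fun θ => stepChar d θ ^ m *
        Real.cos (∑ j, ((rwStep d i s a j - b j : ℤ) : ℝ) * θ j)) (torusMeasure d) :=
      fun i s => integrable_stepChar_pow_mul_cos d m _ (by fun_prop)
    simp_rw [← integral_finsetSum _ (fun s _ => hI _ s)]
    rw [← integral_finsetSum _ (fun i _ => integrable_finsetSum _ fun s _ => hI i s),
      ← integral_const_mul]
    refine integral_congr_ae (ae_of_all _ fun θ => ?_)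
    simp only [sum_rwStep_sub_mul, Fintype.sum_bool, if_true]
    set A := ∑ j, ((a j - b j : ℤ) : ℝ) * θ j
    have : ∀ i, stepChar d θ ^ m * Real.cos (A + θ i)
        + stepChar d θ ^ m * Real.cos (A + (if false = true then θ i else -θ i))
        = 2 * (stepChar d θ ^ m * Real.cos A) * Real.cos (θ i) := by
      intro i
      simp [Real.cos_add]
      ring
    simp_rw [this, ← Finset.mul_sum]
    rw [pow_succ]
    nth_rewrite 3 [stepChar]
    rcases Nat.eq_zero_or_pos d with rfl | hd
    · simp
    · field_simp

lemma rwP_symm (d m : ℕ) (a b : Zd d) : rwP d m a b = rwP d m b a := by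
  rw [rwP_eq_integral, rwP_eq_integral]
  congr 2
  ext θ
  rw [← Real.cos_neg, ← Finset.sum_neg_distrib]
  congr 3
  ext j
  push_cast; ring

lemma rwP_self (d m : ℕ) (a : Zd d) : rwP d m a a = rwP d m 0 0 := by
  rw [rwP_eq_integral, rwP_eq_integral]
  simp

lemma rwP_nonneg (d m : ℕ) (a b : Zd d) : 0 ≤ rwP d m a b := by
  induction m generalizing a with
  | zero => simp only [rwP]; split_ifs <;> norm_num
  | succ m ih =>
    simp only [rwP]
    exact mul_nonneg (by positivity) (Finset.sum_nonneg fun i _ => Finset.sum_nonneg fun s _ => ih _)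

lemma distInf_rwStep_le (d : ℕ) (i : Fin d) (s : Bool) (a b : Zd d) :
    distInf d a b ≤ distInf d (rwStep d i s a) b + 1 := by
  unfold distInf
  norm_cast
  refine Finset.sup_le fun j _ => ?_
  have h := Finset.le_sup (f := fun j => (rwStep d i s a j - b j).natAbs) (Finset.mem_univ j)
  refine le_trans ?_ (Nat.add_le_add_right h 1)
  unfold rwStep
  by_cases hj : j = i
  · subst hj
    cases s <;> simp <;> omega
  · simp [hj]

lemma rwP_eq_zero_of_lt (d m : ℕ) (a b : Zd d) (h : (m : ℝ) < distInf d a b) : rwP d m a b = 0 := by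
  induction m generalizing a with
  | zero =>
    have : a ≠ b := by
      rintro rfl
      simp [distInf] at h
    simp [rwP, this]
  | succ m ih =>
    simp only [rwP]
    rw [Finset.sum_eq_zero fun i _ => Finset.sum_eq_zero fun s _ => ih _ ?_, mul_zero]
    have := distInf_rwStep_le d i s a b
    push_cast at h
    linarith

lemma one_sub_abs_cos_ge (t : ℝ) : Real.sin t ^ 2 / 2 ≤ 1 - |Real.cos t| := by
  have h1 := Real.sin_sq_add_cos_sq t
  have h2 := sq_abs (Real.cos t)
  nlinarith [sq_nonneg (1 - |Real.cos t|)]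

lemma sq_le_sin_sq {t : ℝ} (h : |t| ≤ π / 2) : (2 / π) ^ 2 * t ^ 2 ≤ Real.sin t ^ 2 := by
  have := Real.mul_abs_le_abs_sin h
  rw [← sq_abs t, ← sq_abs (Real.sin t), ← mul_pow]
  gcongr

lemma integral_exp_abs_cos_le {c : ℝ} (hc : 0 < c) :
    ∫ t in Set.Ioc (-π) π, Real.exp (-c * (1 - |Real.cos t|))
      ≤ 3 * √(π / (c * (2 / π) ^ 2 / 2)) := by
  set b := c * (2 / π) ^ 2 / 2 with hb
  have hbpos : 0 < b := by positivity
  have hG : ∀ s : ℝ, Integrable (fun t : ℝ => Real.exp (-b * (t - s) ^ 2)) := fun s =>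
    (integrable_exp_neg_mul_sq hbpos).comp_sub_right s
  have hI : ∀ s : ℝ, ∫ t : ℝ, Real.exp (-b * (t - s) ^ 2) = √(π / b) := fun s => by
    rw [integral_sub_right_eq_self (fun t => Real.exp (-b * t ^ 2)) s, integral_gaussian]
  have key : ∀ t s : ℝ, Real.sin t ^ 2 = Real.sin (t - s) ^ 2 → |t - s| ≤ π / 2 →
      Real.exp (-c * (1 - |Real.cos t|)) ≤ Real.exp (-b * (t - s) ^ 2) := by
    intro t s h1 h2
    refine Real.exp_le_exp.2 ?_
    have h3 := sq_le_sin_sq h2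
    have h4 := one_sub_abs_cos_ge t
    rw [h1] at h4
    have : b * (t - s) ^ 2 ≤ c * (1 - |Real.cos t|) := by
      calc b * (t - s) ^ 2 = c * ((2 / π) ^ 2 * (t - s) ^ 2 / 2) := by rw [hb]; ring
        _ ≤ _ := by gcongr; linarith
    linarith
  have hpi := Real.pi_pos
  calc ∫ t in Set.Ioc (-π) π, Real.exp (-c * (1 - |Real.cos t|))
      ≤ ∫ t in Set.Ioc (-π) π, (Real.exp (-b * (t - 0) ^ 2) + Real.exp (-b * (t - π) ^ 2)
          + Real.exp (-b * (t - (-π)) ^ 2)) := by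
        refine setIntegral_mono_on ?_ ?_ measurableSet_Ioc ?_
        · exact (Continuous.integrableOn_Icc (by fun_prop)).mono_set Set.Ioc_subset_Icc_self
        · exact (((hG 0).add (hG π)).add (hG (-π))).integrableOn
        · intro t ht
          have p0 := (Real.exp_pos (-b * (t - 0) ^ 2)).le
          have p1 := (Real.exp_pos (-b * (t - π) ^ 2)).le
          have p2 := (Real.exp_pos (-b * (t - (-π)) ^ 2)).le
          by_cases h1 : t < -(π / 2)
          · have := key t (-π) (by rw [sub_neg_eq_add, Real.sin_add_pi, neg_sq])
              (abs_le.2 ⟨by linarith [ht.1], by linarith⟩)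
            linarith
          · by_cases h2 : π / 2 < t
            · have := key t π (by rw [Real.sin_sub_pi, neg_sq])
                (abs_le.2 ⟨by linarith, by linarith [ht.2]⟩)
              linarith
            · have := key t 0 (by simp) (abs_le.2 ⟨by linarith, by linarith⟩)
              linarith
    _ ≤ ∫ t, (Real.exp (-b * (t - 0) ^ 2) + Real.exp (-b * (t - π) ^ 2)
          + Real.exp (-b * (t - (-π)) ^ 2)) := by
        refine setIntegral_le_integral (((hG 0).add (hG π)).add (hG (-π))) (ae_of_all _ fun t => ?_)
        simp only [Pi.zero_apply]
        positivity
    _ = 3 * √(π / b) := by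
        rw [integral_add (f := fun t => Real.exp (-b * (t - 0) ^ 2) + Real.exp (-b * (t - π) ^ 2))
          ((hG 0).add (hG π)) (hG (-π)), integral_add (hG 0) (hG π), hI, hI, hI]
        ring

/-- On-diagonal heat kernel bound. -/
lemma exists_rwP_le (d : ℕ) (hd : 3 ≤ d) :
    ∃ C : ℝ, 0 < C ∧ ∀ m : ℕ, 1 ≤ m → ∀ a b : Zd d, rwP d m a b ≤ C * (√m ^ 3)⁻¹ := by
  have hpi := Real.pi_pos
  have hd0 : (0 : ℝ) < d := by exact_mod_cast (by omega : 0 < d)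
  set D : ℝ := 3 * √(π / (1 / d * (2 / π) ^ 2 / 2)) with hD
  have hDpos : 0 < D := by positivity
  refine ⟨((2 * π) ^ d)⁻¹ * D ^ d, by positivity, fun m hm a b => ?_⟩
  have hm0 : (0 : ℝ) < m := by exact_mod_cast hm
  rw [rwP_eq_integral, mul_assoc]
  refine mul_le_mul_of_nonneg_left ?_ (by positivity)
  have hint : Integrable (fun t => Real.exp (-(m / d : ℝ) * (1 - |Real.cos t|)))
      (volume.restrict (Set.Ioc (-π) π)) :=
    (Continuous.integrableOn_Icc (by fun_prop)).mono_set Set.Ioc_subset_Icc_self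
  calc _ ≤ ∫ θ, ∏ i, Real.exp (-(m / d : ℝ) * (1 - |Real.cos (θ i)|)) ∂(torusMeasure d) := by
        refine integral_mono (integrable_stepChar_pow_mul_cos d m _ (by fun_prop)) ?_ fun θ => ?_
        · exact Integrable.fintype_prod
            (f := fun (_ : Fin d) t => Real.exp (-(m / d : ℝ) * (1 - |Real.cos t|)))
            fun _ => hint
        · rw [← Real.exp_sum]
          have h1 : |stepChar d θ| ≤ Real.exp (-(1 / d) * ∑ i, (1 - |Real.cos (θ i)|)) := by
            refine (abs_stepChar_le d θ).trans (le_trans ?_ (Real.add_one_le_exp _))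
            rw [Finset.sum_sub_distrib]
            simp
            field_simp
            linarith
          calc stepChar d θ ^ m * Real.cos (∑ j, ((a j - b j : ℤ) : ℝ) * θ j)
              ≤ |stepChar d θ ^ m * Real.cos (∑ j, ((a j - b j : ℤ) : ℝ) * θ j)| := le_abs_self _
            _ ≤ |stepChar d θ| ^ m := by
              rw [abs_mul, abs_pow]
              exact mul_le_of_le_one_right (by positivity) (Real.abs_cos_le_one _)
            _ ≤ Real.exp (-(1 / d) * ∑ i, (1 - |Real.cos (θ i)|)) ^ m := by gcongr
            _ = _ := by
              rw [← Real.exp_nat_mul, ← Finset.mul_sum]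
              congr 1
              ring
    _ = (∫ t in Set.Ioc (-π) π, Real.exp (-(m / d : ℝ) * (1 - |Real.cos t|))) ^ d := by
        unfold torusMeasure
        rw [integral_fintype_prod_eq_pow (𝕜 := ℝ)
          (f := fun t => Real.exp (-(m / d : ℝ) * (1 - |Real.cos t|)))]
        simp
    _ ≤ (D * (√m)⁻¹) ^ d := by
        refine pow_le_pow_left₀ (integral_nonneg fun t => (Real.exp_pos _).le) ?_ d
        refine (integral_exp_abs_cos_le (by positivity)).trans (le_of_eq ?_)
        rw [hD, mul_assoc, ← Real.sqrt_inv, ← Real.sqrt_mul (by positivity)]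
        congr 2
        field_simp
    _ ≤ D ^ d * (√m ^ 3)⁻¹ := by
        rw [mul_pow, inv_pow]
        have : (1 : ℝ) ≤ √m := Real.one_le_sqrt.2 (by exact_mod_cast hm)
        gcongr

lemma inv_sqrt_pow_three_le (m : ℕ) (hm : 1 ≤ m) :
    (√((m + 1 : ℕ) : ℝ) ^ 3)⁻¹ ≤ 2 * ((√(m : ℝ))⁻¹ - (√((m + 1 : ℕ) : ℝ))⁻¹) := by
  have hm0 : (0 : ℝ) < m := by exact_mod_cast hm
  set x := √(m : ℝ) with hx
  set y := √((m + 1 : ℕ) : ℝ) with hy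
  have hx0 : 0 < x := Real.sqrt_pos.2 hm0
  have hx2 : x ^ 2 = m := Real.sq_sqrt hm0.le
  have hy2 : y ^ 2 = m + 1 := by rw [hy, Real.sq_sqrt (by positivity)]; push_cast; ring
  have hxy : x < y := Real.sqrt_lt_sqrt hm0.le (by push_cast; linarith)
  have hy0 : 0 < y := hx0.trans hxy
  have h1 : (y - x) * (y + x) = 1 := by nlinarith
  have h2 : x⁻¹ - y⁻¹ = (y - x) / (x * y) := by field_simp
  have h3 : y - x = 1 / (y + x) := by field_simp; linarith
  rw [h2, h3, inv_eq_one_div, div_div, ← mul_div_assoc, mul_one, div_le_div_iff₀ (by positivity) (by positivity)]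
  have : (y + x) * (x * y) ≤ (y + y) * (y * y) := by gcongr
  nlinarith

lemma summable_rwP (d : ℕ) (hd : 3 ≤ d) (a b : Zd d) : Summable fun m => rwP d m a b := by
  obtain ⟨C, hC, h⟩ := exists_rwP_le d hd
  rw [← summable_nat_add_iff 1]
  refine Summable.of_nonneg_of_le (fun m => rwP_nonneg _ _ _ _) (fun m => h (m + 1) (by omega) a b) ?_
  refine Summable.mul_left _ ?_
  rw [summable_nat_add_iff 1 (f := fun m : ℕ => (√(m : ℝ) ^ 3)⁻¹)]
  refine (Real.summable_nat_rpow_inv (p := 3 / 2)).2 (by norm_num) |>.congr fun m => ?_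
  rw [Real.sqrt_eq_rpow, ← Real.rpow_natCast, ← Real.rpow_mul (by positivity)]
  norm_num

lemma green_nonneg (d : ℕ) (a b : Zd d) : 0 ≤ green d a b := tsum_nonneg fun _ => rwP_nonneg _ _ _ _

lemma green_symm (d : ℕ) (a b : Zd d) : green d a b = green d b a := by
  unfold green; simp_rw [rwP_symm d _ a b]

lemma green_self (d : ℕ) (a : Zd d) : green d a a = green d 0 0 := by
  unfold green; simp_rw [rwP_self d _ a]

lemma one_le_green_zero (d : ℕ) (hd : 3 ≤ d) : 1 ≤ green d 0 0 := by
  have := (summable_rwP d hd 0 0).le_tsum 0 fun m _ => rwP_nonneg _ _ _ _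
  simpa [rwP, green] using this

/-- Off-diagonal decay of the Green's function. -/
lemma exists_green_le (d : ℕ) (hd : 3 ≤ d) :
    ∃ C : ℝ, 0 < C ∧ ∀ (r : ℕ), 1 ≤ r → ∀ a b : Zd d, (r : ℝ) < distInf d a b →
      green d a b ≤ C * (√r)⁻¹ := by
  obtain ⟨C, hC, h⟩ := exists_rwP_le d hd
  refine ⟨2 * C, by positivity, fun r hr a b hab => ?_⟩
  have hr0 : (0 : ℝ) < r := by exact_mod_cast hr
  refine Real.tsum_le_of_sum_range_le (fun m => rwP_nonneg _ _ _ _) fun n => ?_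
  have hzero : ∀ k ≤ r + 1, ∑ m ∈ Finset.range k, rwP d m a b = 0 := fun k hk =>
    Finset.sum_eq_zero fun m hm => rwP_eq_zero_of_lt d m a b (lt_of_le_of_lt (by
      have := Finset.mem_range.1 hm
      exact_mod_cast (by omega : m ≤ r)) hab)
  have hstep : ∀ k, ∑ m ∈ Finset.range (r + 1 + k), rwP d m a b
      ≤ 2 * C * ((√r)⁻¹ - (√((r + k : ℕ) : ℝ))⁻¹) := by
    intro k
    induction k with
    | zero => simp [hzero]
    | succ k ih =>
      rw [← add_assoc, Finset.sum_range_succ]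
      have h1 := h (r + 1 + k) (by omega) a b
      have h2 := inv_sqrt_pow_three_le (r + k) (by omega)
      rw [show r + 1 + k = r + k + 1 by ring] at h1 ih ⊢
      rw [show r + (k + 1) = r + k + 1 by ring]
      nlinarith
  rcases le_total n (r + 1) with hn | hn
  · rw [hzero n hn]; positivity
  · obtain ⟨k, rfl⟩ := Nat.exists_eq_add_of_le hn
    refine (hstep k).trans ?_
    have : 0 ≤ (√((r + k : ℕ) : ℝ))⁻¹ := by positivity
    gcongr
    linarith

/-! ### A Dirichlet form inequality for the Green's function -/

lemma rwStep_rwStep_not (d : ℕ) (i : Fin d) (s : Bool) (a : Zd d) :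
    rwStep d i (!s) (rwStep d i s a) = a := by
  ext j
  unfold rwStep
  by_cases h : j = i
  · subst h; cases s <;> simp
  · simp [h]

/-- The shift `rwStep d i s` as a permutation of `ℤ^d`. -/
def rwStepEquiv (d : ℕ) (i : Fin d) (s : Bool) : Zd d ≃ Zd d where
  toFun := rwStep d i s
  invFun := rwStep d i (!s)
  left_inv := rwStep_rwStep_not d i s
  right_inv a := by simpa using rwStep_rwStep_not d i (!s) a

/-- The transition operator of the simple random walk. -/
noncomputable def walkAvg (d : ℕ) (f : Zd d → ℝ) (x : Zd d) : ℝ :=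
  (1 / (2 * d)) * ∑ i : Fin d, ∑ s : Bool, f (rwStep d i s x)

lemma summable_comp_rwStep {d : ℕ} {f : Zd d → ℝ} (hf : Summable f) (i : Fin d) (s : Bool) :
    Summable fun x => f (rwStep d i s x) :=
  (rwStepEquiv d i s).summable_iff.2 hf

lemma tsum_comp_rwStep {d : ℕ} (f : Zd d → ℝ) (i : Fin d) (s : Bool) :
    ∑' x, f (rwStep d i s x) = ∑' x, f x :=
  (rwStepEquiv d i s).tsum_eq f

lemma summable_walkAvg {d : ℕ} {f : Zd d → ℝ} (hf : Summable f) : Summable (walkAvg d f) :=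
  (summable_sum fun i _ => summable_sum fun s _ => summable_comp_rwStep hf i s).mul_left _

lemma tsum_walkAvg {d : ℕ} (hd : 0 < d) {f : Zd d → ℝ} (hf : Summable f) :
    ∑' x, walkAvg d f x = ∑' x, f x := by
  unfold walkAvg
  rw [tsum_mul_left, Summable.tsum_finsetSum fun i _ => summable_sum fun s _ => summable_comp_rwStep hf i s]
  simp_rw [Summable.tsum_finsetSum fun s (_ : s ∈ Finset.univ) => summable_comp_rwStep hf _ s,
    tsum_comp_rwStep]
  have : (0 : ℝ) < d := by exact_mod_cast hd
  simp
  field_simp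

lemma hasSum_rwP {d : ℕ} (hd : 0 < d) (m : ℕ) (b : Zd d) : HasSum (fun x => rwP d m x b) 1 := by
  induction m with
  | zero => simpa [rwP] using hasSum_ite_eq b (1 : ℝ)
  | succ m ih =>
    have h1 := tsum_walkAvg hd ih.summable
    rw [ih.tsum_eq] at h1
    have h2 := (summable_walkAvg ih.summable).hasSum
    rwa [h1] at h2

lemma summable_mul_of_summable {ι : Type*} {f h : ι → ℝ} (hf : Summable f) (hh : Summable h) :
    Summable fun x => f x * h x :=
  (summable_mul_of_summable_norm hf.norm hh.norm).comp_injective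
    (i := fun x : ι => (x, x)) fun _ _ h => (Prod.ext_iff.1 h).1

lemma tsum_mul_walkAvg {d : ℕ} {f h : Zd d → ℝ} (hf : Summable f) (hh : Summable h) :
    ∑' x, f x * walkAvg d h x
      = (1 / (2 * d)) * ∑ i : Fin d, ∑ s : Bool, ∑' x, f x * h (rwStep d i s x) := by
  have hs : ∀ i s, Summable fun x => f x * h (rwStep d i s x) := fun i s =>
    summable_mul_of_summable hf (summable_comp_rwStep hh i s)
  simp_rw [← Summable.tsum_finsetSum fun s (_ : s ∈ Finset.univ) => hs _ s]
  rw [← Summable.tsum_finsetSum fun i _ => summable_sum fun s _ => hs i s, ← tsum_mul_left]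
  refine tsum_congr fun x => ?_
  unfold walkAvg
  simp_rw [← Finset.mul_sum]
  ring

lemma tsum_mul_walkAvg_comm {d : ℕ} {f h : Zd d → ℝ} (hf : Summable f) (hh : Summable h) :
    ∑' x, f x * walkAvg d h x = ∑' x, h x * walkAvg d f x := by
  rw [tsum_mul_walkAvg hf hh, tsum_mul_walkAvg hh hf]
  congr 1
  refine Finset.sum_congr rfl fun i _ => ?_
  have key : ∀ s, ∑' x, f x * h (rwStep d i s x) = ∑' x, h x * f (rwStep d i (!s) x) := by
    intro s
    rw [← tsum_comp_rwStep (fun x => h x * f (rwStep d i (!s) x)) i s]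
    refine tsum_congr fun x => ?_
    rw [rwStep_rwStep_not, mul_comm]
  rw [Fintype.sum_bool, Fintype.sum_bool, key, key, add_comm]
  rfl

lemma tsum_mul_walkAvg_self_le {d : ℕ} (hd : 0 < d) {f : Zd d → ℝ} (hf : Summable f) :
    ∑' x, f x * walkAvg d f x ≤ ∑' x, f x * f x := by
  have hff := summable_mul_of_summable hf hf
  have hd0 : (0 : ℝ) < d := by exact_mod_cast hd
  have h1 : ∀ x, f x * walkAvg d f x
      ≤ (1 / 2) * (f x * f x) + (1 / 2) * walkAvg d (fun y => f y * f y) x := by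
    intro x
    have hx : f x * f x = (1 / (2 * d)) * ∑ i : Fin d, ∑ s : Bool, f x * f x := by
      simp; field_simp
    have hS : f x * ∑ i : Fin d, ∑ s : Bool, f (rwStep d i s x)
        ≤ (1 / 2) * ∑ i : Fin d, ∑ s : Bool, f x * f x
          + (1 / 2) * ∑ i : Fin d, ∑ s : Bool, f (rwStep d i s x) * f (rwStep d i s x) := by
      simp only [Finset.mul_sum, ← Finset.sum_add_distrib]
      refine Finset.sum_le_sum fun i _ => Finset.sum_le_sum fun s _ => ?_
      nlinarith [sq_nonneg (f x - f (rwStep d i s x))]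
    have hk : (0 : ℝ) ≤ 1 / (2 * d) := by positivity
    rw [hx]
    unfold walkAvg
    nlinarith [mul_le_mul_of_nonneg_left hS hk]
  have h2 := Summable.tsum_le_tsum h1 (summable_mul_of_summable hf (summable_walkAvg hf))
    ((hff.mul_left (1 / 2)).add ((summable_walkAvg hff).mul_left (1 / 2)))
  rw [(hff.mul_left (1 / 2)).tsum_add ((summable_walkAvg hff).mul_left (1 / 2)), tsum_mul_left, tsum_mul_left,
    tsum_walkAvg hd hff] at h2
  linarith

/-- The operator `1 - t P`, where `P` is the transition operator of the simple random walk. -/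
noncomputable def massiveLap (d : ℕ) (t : ℝ) (f : Zd d → ℝ) (x : Zd d) : ℝ := f x - t * walkAvg d f x

lemma summable_mul_massiveLap {d : ℕ} {t : ℝ} {f h : Zd d → ℝ} (hf : Summable f) (hh : Summable h) :
    Summable fun x => f x * massiveLap d t h x :=
  summable_mul_of_summable hf (hh.sub ((summable_walkAvg hh).mul_left t))

lemma tsum_mul_massiveLap {d : ℕ} {t : ℝ} {f h : Zd d → ℝ} (hf : Summable f) (hh : Summable h) :
    ∑' x, f x * massiveLap d t h x = ∑' x, f x * h x - t * ∑' x, f x * walkAvg d h x := by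
  rw [← tsum_mul_left, ← (summable_mul_of_summable hf hh).tsum_sub
    ((summable_mul_of_summable hf (summable_walkAvg hh)).mul_left t)]
  refine tsum_congr fun x => ?_
  unfold massiveLap
  ring

lemma tsum_mul_massiveLap_comm {d : ℕ} {t : ℝ} {f h : Zd d → ℝ} (hf : Summable f)
    (hh : Summable h) :
    ∑' x, f x * massiveLap d t h x = ∑' x, h x * massiveLap d t f x := by
  rw [tsum_mul_massiveLap hf hh, tsum_mul_massiveLap hh hf, tsum_mul_walkAvg_comm hf hh]
  simp_rw [mul_comm (f _)]

lemma tsum_mul_massiveLap_self_nonneg {d : ℕ} (hd : 0 < d) {t : ℝ} (ht0 : 0 ≤ t) (ht1 : t ≤ 1)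
    {f : Zd d → ℝ} (hf : Summable f) : 0 ≤ ∑' x, f x * massiveLap d t f x := by
  rw [tsum_mul_massiveLap hf hf]
  have h1 := tsum_mul_walkAvg_self_le hd hf
  have h2 : 0 ≤ ∑' x, f x * f x := tsum_nonneg fun x => mul_self_nonneg _
  nlinarith

/-- The Green's function of the simple random walk killed at each step with probability `1 - t`. -/
noncomputable def massiveGreen (d : ℕ) (t : ℝ) (a b : Zd d) : ℝ := ∑' m, rwP d m a b * t ^ m

lemma rwP_le_one {d : ℕ} (hd : 0 < d) (m : ℕ) (a b : Zd d) : rwP d m a b ≤ 1 :=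
  le_hasSum (hasSum_rwP hd m b) a fun x _ => rwP_nonneg d m x b

lemma summable_rwP_mul_pow {d : ℕ} (hd : 0 < d) {t : ℝ} (ht0 : 0 ≤ t) (ht1 : t < 1) (a b : Zd d) :
    Summable fun m => rwP d m a b * t ^ m :=
  Summable.of_nonneg_of_le (fun m => mul_nonneg (rwP_nonneg _ _ _ _) (by positivity))
    (fun m => mul_le_of_le_one_left (by positivity) (rwP_le_one hd m a b))
    (summable_geometric_of_lt_one ht0 ht1)

lemma massiveGreen_nonneg (d : ℕ) {t : ℝ} (ht0 : 0 ≤ t) (a b : Zd d) : 0 ≤ massiveGreen d t a b :=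
  tsum_nonneg fun m => mul_nonneg (rwP_nonneg d m a b) (by positivity)

lemma summable_massiveGreen {d : ℕ} (hd : 0 < d) {t : ℝ} (ht0 : 0 ≤ t) (ht1 : t < 1) (b : Zd d) :
    Summable fun x => massiveGreen d t x b := by
  have hnn : ∀ p : ℕ × Zd d, 0 ≤ rwP d p.1 p.2 b * t ^ p.1 := fun p =>
    mul_nonneg (rwP_nonneg d p.1 p.2 b) (pow_nonneg ht0 p.1)
  have h1 : ∀ m : ℕ, HasSum (fun x => rwP d m x b * t ^ m) (t ^ m) := fun m => by
    simpa using (hasSum_rwP hd m b).mul_right (t ^ m)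
  have h2 : Summable fun m : ℕ => ∑' x, rwP d m x b * t ^ m := by
    simp_rw [fun m => (h1 m).tsum_eq]
    exact summable_geometric_of_lt_one ht0 ht1
  have h : Summable fun p : ℕ × Zd d => rwP d p.1 p.2 b * t ^ p.1 :=
    (summable_prod_of_nonneg hnn).2 ⟨fun m => (h1 m).summable, h2⟩
  exact h.prod_symm.prod

lemma massiveLap_massiveGreen {d : ℕ} (hd : 0 < d) {t : ℝ} (ht0 : 0 ≤ t) (ht1 : t < 1) (b x : Zd d) :
    massiveLap d t (fun y => massiveGreen d t y b) x = if x = b then 1 else 0 := by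
  unfold massiveLap
  have hs := fun a => summable_rwP_mul_pow hd ht0 ht1 a b
  have h1 : massiveGreen d t x b
      = rwP d 0 x b + ∑' m, rwP d (m + 1) x b * t ^ (m + 1) := by
    have := (hs x).tsum_eq_zero_add
    simpa [massiveGreen] using this
  have h2 : ∑' m, rwP d (m + 1) x b * t ^ (m + 1)
      = t * walkAvg d (fun y => massiveGreen d t y b) x := by
    unfold walkAvg massiveGreen
    simp_rw [← Summable.tsum_finsetSum fun s (_ : s ∈ Finset.univ) => hs (rwStep d _ s x)]
    rw [← Summable.tsum_finsetSum fun i _ => summable_sum fun s _ => hs (rwStep d i s x),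
      ← tsum_mul_left, ← tsum_mul_left]
    refine tsum_congr fun m => ?_
    simp only [rwP, ← Finset.sum_mul]
    ring
  simp only [h1, h2]
  simp [rwP]

lemma walkAvg_le {d : ℕ} (hd : 0 < d) {f : Zd d → ℝ} {M : ℝ} (hf : ∀ x, f x ≤ M) (x : Zd d) :
    walkAvg d f x ≤ M := by
  have hd0 : (0 : ℝ) < d := by exact_mod_cast hd
  unfold walkAvg
  calc (1 / (2 * d)) * ∑ i : Fin d, ∑ s : Bool, f (rwStep d i s x)
      ≤ (1 / (2 * d)) * ∑ i : Fin d, ∑ s : Bool, M := by gcongr; exact hf _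
    _ = M := by simp; field_simp

lemma two_mul_sum_massiveGreen_le {d : ℕ} (hd : 0 < d) {t : ℝ} (ht0 : 0 ≤ t) (ht1 : t < 1)
    (K : Finset (Zd d)) (c : Zd d → ℝ) (a : Zd d) {M : ℝ} (hM : 0 ≤ M)
    (hK : ∀ b ∈ K, massiveGreen d t b a ≤ M) :
    2 * ∑ b ∈ K, c b * massiveGreen d t b a
      ≤ ∑ b ∈ K, ∑ b' ∈ K, c b * c b' * massiveGreen d t b b' + M := by
  set h : Zd d → ℝ := fun x => massiveGreen d t x a with hh
  set F : Zd d → ℝ := fun x => ∑ b ∈ K, c b * massiveGreen d t x b with hF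
  set u : Zd d → ℝ := fun x => min (h x) M with hu
  have h0 : ∀ x, 0 ≤ h x := fun x => massiveGreen_nonneg d ht0 x a
  have hsum : Summable h := summable_massiveGreen hd ht0 ht1 a
  have Fsum : Summable F := summable_sum fun b _ => (summable_massiveGreen hd ht0 ht1 b).mul_left _
  have usum : Summable u := Summable.of_nonneg_of_le (fun x => le_min (h0 x) hM)
    (fun x => min_le_left _ _) hsum
  have hLh : ∀ x, massiveLap d t h x = if x = a then 1 else 0 :=
    massiveLap_massiveGreen hd ht0 ht1 a
  have hLF : ∀ x, massiveLap d t F x = ∑ b ∈ K, c b * if x = b then 1 else 0 := by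
    intro x
    simp_rw [← massiveLap_massiveGreen hd ht0 ht1]
    simp only [massiveLap, hF, walkAvg, mul_sub, Finset.sum_sub_distrib]
    congr 1
    simp only [Finset.mul_sum]
    simp_rw [Finset.sum_comm (t := K)]
    exact Finset.sum_congr rfl fun b _ => Finset.sum_congr rfl fun i _ =>
      Finset.sum_congr rfl fun s _ => by ring
  have htest : ∀ f : Zd d → ℝ, ∑' x, f x * massiveLap d t F x = ∑ b ∈ K, c b * f b := by
    intro f
    rw [tsum_eq_sum (s := K)]
    · refine Finset.sum_congr rfl fun x hx => ?_
      rw [hLF, Finset.sum_eq_single x (fun b _ hb => by simp [hb.symm]) (fun h => absurd hx h)]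
      simp [mul_comm]
    · intro x hx
      rw [hLF, Finset.sum_eq_zero, mul_zero]
      intro b hb
      have : x ≠ b := fun h => hx (h ▸ hb)
      simp [this]
  have huM : ∑' x, u x * massiveLap d t u x ≤ M := by
    calc ∑' x, u x * massiveLap d t u x ≤ ∑' x, h x * massiveLap d t u x := by
          refine Summable.tsum_le_tsum (fun x => ?_) (summable_mul_massiveLap usum usum)
            (summable_mul_massiveLap hsum usum)
          rcases le_total (h x) M with hx | hx
          · simp [hu, hx]
          · have h1 : walkAvg d u x ≤ M := walkAvg_le hd (fun y => min_le_right _ _) x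
            have h2 : u x = M := min_eq_right hx
            refine mul_le_mul_of_nonneg_right (min_le_left _ _) ?_
            unfold massiveLap
            rw [h2]
            nlinarith
      _ = ∑' x, u x * massiveLap d t h x := tsum_mul_massiveLap_comm hsum usum
      _ = u a := by simp_rw [hLh]; simp
      _ ≤ M := min_le_right _ _
  have hw := tsum_mul_massiveLap_self_nonneg hd ht0 ht1.le (Fsum.sub usum)
  have hexp : ∀ x, (F x - u x) * massiveLap d t (fun y => F y - u y) x
      = F x * massiveLap d t F x - F x * massiveLap d t u x
        - (u x * massiveLap d t F x - u x * massiveLap d t u x) := by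
    intro x
    have : massiveLap d t (fun y => F y - u y) x = massiveLap d t F x - massiveLap d t u x := by
      simp only [massiveLap, walkAvg, Finset.sum_sub_distrib]
      ring
    rw [this]; ring
  simp_rw [hexp] at hw
  rw [((summable_mul_massiveLap Fsum Fsum).sub (summable_mul_massiveLap Fsum usum)).tsum_sub
      ((summable_mul_massiveLap usum Fsum).sub (summable_mul_massiveLap usum usum)),
    (summable_mul_massiveLap Fsum Fsum).tsum_sub (summable_mul_massiveLap Fsum usum),
    (summable_mul_massiveLap usum Fsum).tsum_sub (summable_mul_massiveLap usum usum),
    tsum_mul_massiveLap_comm Fsum usum, htest, htest] at hw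
  have hu' : ∑ b ∈ K, c b * u b = ∑ b ∈ K, c b * massiveGreen d t b a :=
    Finset.sum_congr rfl fun b hb => by rw [hu]; simp only [hh]; rw [min_eq_left (hK b hb)]
  have hF' : ∑ b ∈ K, c b * F b = ∑ b ∈ K, ∑ b' ∈ K, c b * c b' * massiveGreen d t b b' :=
    Finset.sum_congr rfl fun b _ => by
      simp only [hF, Finset.mul_sum]
      exact Finset.sum_congr rfl fun b' _ => by ring
  rw [hu', hF'] at hw
  linarith

lemma tendsto_massiveGreen {d : ℕ} (hd : 3 ≤ d) (a b : Zd d) :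
    Tendsto (fun t => massiveGreen d t a b) (nhdsWithin 1 (Set.Iio 1)) (nhds (green d a b)) :=
  Real.tendsto_tsum_powerSeries_nhdsWithin_lt (summable_rwP d hd a b).hasSum.tendsto_sum_nat

lemma massiveGreen_le_green {d : ℕ} (hd : 3 ≤ d) {t : ℝ} (ht0 : 0 ≤ t) (ht1 : t < 1) (a b : Zd d) :
    massiveGreen d t a b ≤ green d a b :=
  (summable_rwP_mul_pow (by omega) ht0 ht1 a b).tsum_le_tsum
    (fun m => mul_le_of_le_one_right (rwP_nonneg d m a b) (pow_le_one₀ ht0 ht1.le))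
    (summable_rwP d hd a b)

lemma two_mul_sum_green_le {d : ℕ} (hd : 3 ≤ d) (K : Finset (Zd d)) (c : Zd d → ℝ) (a : Zd d)
    {M : ℝ} (hM : 0 ≤ M) (hK : ∀ b ∈ K, green d b a ≤ M) :
    2 * ∑ b ∈ K, c b * green d b a ≤ ∑ b ∈ K, ∑ b' ∈ K, c b * c b' * green d b b' + M := by
  have hl : Tendsto (fun t => 2 * ∑ b ∈ K, c b * massiveGreen d t b a) (nhdsWithin 1 (Set.Iio 1))
      (nhds (2 * ∑ b ∈ K, c b * green d b a)) :=
    (tendsto_finsetSum _ fun b _ => (tendsto_massiveGreen hd b a).const_mul _).const_mul _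
  have hr : Tendsto (fun t => ∑ b ∈ K, ∑ b' ∈ K, c b * c b' * massiveGreen d t b b' + M)
      (nhdsWithin 1 (Set.Iio 1)) (nhds (∑ b ∈ K, ∑ b' ∈ K, c b * c b' * green d b b' + M)) :=
    (tendsto_finsetSum _ fun b _ => tendsto_finsetSum _ fun b' _ =>
      (tendsto_massiveGreen hd b b').const_mul _).add_const M
  refine le_of_tendsto_of_tendsto hl hr ?_
  filter_upwards [Ioo_mem_nhdsLT (zero_lt_one' ℝ)] with t ht
  exact two_mul_sum_massiveGreen_le (by omega) ht.1.le ht.2 K c a hM fun b hb =>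
    (massiveGreen_le_green hd ht.1.le ht.2 b a).trans (hK b hb)

section GaussianField

variable {Ω : Type*} [MeasurableSpace Ω] {P : Measure Ω} {d : ℕ} {G : Zd d → Zd d → ℝ}
  {φ : Zd d → Ω → ℝ}

lemma IsGaussianField.map_linComb (hφ : IsGaussianField P d G φ) (K : Finset (Zd d))
    (c : Zd d → ℝ) :
    P.map (fun ω => ∑ a ∈ K, c a * φ a ω) =
      gaussianReal 0 (∑ a ∈ K, ∑ b ∈ K, c a * c b * G a b).toNNReal := by
  classical
  have h := hφ.2 (Finsupp.indicator K fun a _ => c a)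
  have hs := Finsupp.support_indicator_subset K (fun a _ => c a)
  have hc : ∀ a ∈ K, Finsupp.indicator K (fun a _ => c a) a = c a := fun a ha => by
    rw [Finsupp.indicator_of_mem ha]
  have h0 : ∀ a, a ∉ (Finsupp.indicator K (fun a _ => c a)).support →
      Finsupp.indicator K (fun a _ => c a) a = 0 := fun a ha => by
    simpa using! ha
  have e1 : (fun ω => ∑ a ∈ (Finsupp.indicator K (fun a _ => c a)).support,
      Finsupp.indicator K (fun a _ => c a) a * φ a ω) = fun ω => ∑ a ∈ K, c a * φ a ω := by
    funext ω
    rw [Finset.sum_subset hs fun a _ ha => by rw [h0 a ha, zero_mul]]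
    exact Finset.sum_congr rfl fun a ha => by rw [hc a ha]
  rw [e1] at h
  rw [h]
  congr 2
  rw [Finset.sum_subset hs fun a _ ha => by simp [h0 a ha]]
  refine Finset.sum_congr rfl fun a ha => ?_
  rw [Finset.sum_subset hs fun b _ hb => by simp [h0 b hb]]
  exact Finset.sum_congr rfl fun b hb => by rw [hc a ha, hc b hb]

lemma IsGaussianField.hasGaussianLaw (hφ : IsGaussianField P d G φ) (K : Finset (Zd d)) :
    HasGaussianLaw (fun ω (a : K) => φ a ω) P := by
  classical
  have hm : Measurable (fun ω (a : K) => φ a ω) := measurable_pi_lambda _ fun a => hφ.1 a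
  refine ⟨isGaussian_of_map_eq_gaussianReal fun L => ?_⟩
  have h := hφ.map_linComb K (fun a => if ha : a ∈ K then L (Pi.single ⟨a, ha⟩ 1) else 0)
  refine ⟨0, _, Eq.trans ?_ h⟩
  rw [Measure.map_map (by fun_prop) hm]
  congr 1
  funext ω
  rw [← Finset.sum_coe_sort K, Function.comp_apply]
  conv_lhs => rw [← Finset.univ_sum_single (fun a : K => φ a ω), map_sum]
  refine Finset.sum_congr rfl fun a _ => ?_
  rw [dif_pos a.2, mul_comm, ← smul_eq_mul, ← map_smul]
  congr 1
  ext b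
  by_cases h : b = a
  · subst h; simp
  · simp [h]

lemma IsGaussianField.memLp (hφ : IsGaussianField P d G φ) (a : Zd d) : MemLp (φ a) 2 P :=
  ((hφ.hasGaussianLaw {a}).eval ⟨a, by simp⟩).memLp_two

lemma IsGaussianField.integral_eq_zero (hφ : IsGaussianField P d G φ) (a : Zd d) :
    ∫ ω, φ a ω ∂P = 0 := by
  have h := hφ.map_linComb {a} 1
  simp only [Finset.sum_singleton, Pi.one_apply, one_mul] at h
  rw [← integral_map (φ := φ a) (f := fun x => x) (hφ.1 a).aemeasurable (by fun_prop), h]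
  simp

lemma IsGaussianField.integral_sq_sum [IsProbabilityMeasure P] (hφ : IsGaussianField P d G φ)
    (K : Finset (Zd d)) (c : Zd d → ℝ) (hc : 0 ≤ ∑ a ∈ K, ∑ b ∈ K, c a * c b * G a b) :
    ∫ ω, (∑ a ∈ K, c a * φ a ω) ^ 2 ∂P = ∑ a ∈ K, ∑ b ∈ K, c a * c b * G a b := by
  have hm : Measurable (fun ω => ∑ a ∈ K, c a * φ a ω) :=
    Finset.measurable_sum _ fun a _ => (hφ.1 a).const_mul _
  have h := hφ.map_linComb K c
  rw [← integral_map (φ := fun ω => ∑ a ∈ K, c a * φ a ω) (f := fun x => x ^ 2)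
    hm.aemeasurable (by fun_prop), h]
  have h2 := variance_fun_id_gaussianReal (μ := 0)
    (v := (∑ a ∈ K, ∑ b ∈ K, c a * c b * G a b).toNNReal)
  rw [variance_eq_integral (by fun_prop), integral_id_gaussianReal] at h2
  simpa [hc] using! h2

lemma IsGaussianField.integral_mul [IsProbabilityMeasure P]
    (hφ : IsGaussianField P d (green d) φ) (a b : Zd d) :
    ∫ ω, φ a ω * φ b ω ∂P = green d a b := by
  classical
  have hsq : ∀ a, ∫ ω, φ a ω ^ 2 ∂P = green d a a := fun a => by
    have := hφ.integral_sq_sum {a} 1 (by simpa using green_nonneg d a a)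
    simpa using this
  rcases eq_or_ne a b with rfl | hab
  · rw [← hsq]; simp only [sq]
  have h := hφ.integral_sq_sum {a, b} 1 (by
    simp only [Pi.one_apply, one_mul]
    exact Finset.sum_nonneg fun _ _ => Finset.sum_nonneg fun _ _ => green_nonneg d _ _)
  simp only [Pi.one_apply, one_mul, Finset.sum_pair hab] at h
  have hi : Integrable (fun ω => φ a ω * φ b ω) P := (hφ.memLp a).integrable_mul (hφ.memLp b)
  have e : (fun ω => (φ a ω + φ b ω) ^ 2) =
      fun ω => φ a ω ^ 2 + 2 * (φ a ω * φ b ω) + φ b ω ^ 2 := by funext ω; ring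
  have hi2 : Integrable (fun ω => φ a ω ^ 2 + 2 * (φ a ω * φ b ω)) P :=
    (hφ.memLp a).integrable_sq.add (hi.const_mul 2)
  rw [e, integral_add hi2 (hφ.memLp b).integrable_sq, integral_add (hφ.memLp a).integrable_sq (hi.const_mul 2),
    hsq, hsq, integral_const_mul, green_symm d b a] at h
  linarith

/-- Existence of the regression coefficients of `φ a` on `(φ b)_{b ∈ K}`. -/
lemma IsGaussianField.exists_regression [IsProbabilityMeasure P]
    (hφ : IsGaussianField P d (green d) φ) (K : Finset (Zd d)) (a : Zd d) :
    ∃ c : Zd d → ℝ, ∀ γ ∈ K, ∑ b ∈ K, c b * green d b γ = green d a γ := by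
  classical
  let F : Zd d → Lp ℝ 2 P := fun b => (hφ.memLp b).toLp (φ b)
  have hF : ∀ b b', inner ℝ (F b) (F b') = green d b b' := fun b b' => by
    rw [L2.inner_def, ← hφ.integral_mul b b']
    refine integral_congr_ae ?_
    filter_upwards [(hφ.memLp b).coeFn_toLp, (hφ.memLp b').coeFn_toLp] with ω h1 h2
    simp only [F, h1, h2, RCLike.inner_apply, conj_trivial, mul_comm]
  let S : Submodule ℝ (Lp ℝ 2 P) := Submodule.span ℝ (F '' (K : Set (Zd d)))
  have : FiniteDimensional ℝ S := FiniteDimensional.span_of_finite ℝ (K.finite_toSet.image F)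
  have hmem : S.starProjection (F a) ∈ S := S.starProjection_apply_mem (F a)
  obtain ⟨c, hc⟩ := (Submodule.mem_span_image_finset_iff_exists_fun ℝ).1 hmem
  refine ⟨fun b => if hb : b ∈ K then c ⟨b, hb⟩ else 0, fun γ hγ => ?_⟩
  have ho := S.sub_starProjection_mem_orthogonal (F a)
  have h := (Submodule.mem_orthogonal' S _).1 ho (F γ) (Submodule.subset_span ⟨γ, hγ, rfl⟩)
  rw [← hc, inner_sub_left, sum_inner, hF] at h
  simp only [inner_smul_left, hF, conj_trivial] at h
  rw [← Finset.sum_coe_sort K]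
  simp only [fun x : K => dif_pos (c := x.1 ∈ K) (t := fun h => c ⟨x.1, h⟩) (e := fun _ => 0) x.2]
  linarith

end GaussianField

section Regression

variable {Ω : Type*} [MeasurableSpace Ω] {P : Measure Ω} {d : ℕ}
  {φ : Zd d → Ω → ℝ}

lemma IsGaussianField.hasGaussianLaw_sub_linComb (hφ : IsGaussianField P d (green d) φ)
    (K : Finset (Zd d)) (a : Zd d) (c : Zd d → ℝ) :
    HasGaussianLaw (fun ω => ((fun b : K => φ b ω),
      fun _ : Unit => φ a ω - ∑ b ∈ K, c b * φ b ω)) P := by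
  classical
  let J : Finset (Zd d) := insert a K
  let pr (b : J) : (J → ℝ) →L[ℝ] ℝ := ContinuousLinearMap.proj b
  let L : (J → ℝ) →L[ℝ] ((K → ℝ) × (Unit → ℝ)) :=
    ContinuousLinearMap.prod
      (ContinuousLinearMap.pi fun b : K =>
        pr ⟨b.1, Finset.mem_insert_of_mem b.2⟩)
      (ContinuousLinearMap.pi fun _ : Unit =>
        pr ⟨a, Finset.mem_insert_self a K⟩ -
          ∑ b : K, c b • pr ⟨b.1, Finset.mem_insert_of_mem b.2⟩)
  have h := (hφ.hasGaussianLaw J).map_fun L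
  have e : (fun ω => L fun b : J => φ b ω) = fun ω => ((fun b : K => φ b ω),
      fun _ : Unit => φ a ω - ∑ b ∈ K, c b * φ b ω) := by
    funext ω
    refine Prod.ext (funext fun _ => rfl) (funext fun _ => ?_)
    simp [L, pr, Finset.sum_attach K (fun b => c b * φ b ω)]
  rwa [e] at h

/-- Decomposition of `φ a` into a linear combination of `(φ b)_{b ∈ K}` of small variance and an
independent Gaussian variable. -/
lemma IsGaussianField.exists_decomposition [IsProbabilityMeasure P] (hd : 3 ≤ d)
    (hφ : IsGaussianField P d (green d) φ) (K : Finset (Zd d)) (a : Zd d) {M : ℝ} (hM : 0 ≤ M)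
    (hK : ∀ b ∈ K, green d b a ≤ M) :
    ∃ (c : Zd d → ℝ) (t : ℝ), 0 ≤ t ∧ t ≤ M ∧
      ∫ ω, (∑ b ∈ K, c b * φ b ω) ^ 2 ∂P = t ∧
      P.map (fun ω => φ a ω - ∑ b ∈ K, c b * φ b ω) =
        gaussianReal 0 (green d 0 0 - t).toNNReal ∧
      IndepFun (fun ω (b : K) => φ b ω) (fun ω => φ a ω - ∑ b ∈ K, c b * φ b ω) P := by
  obtain ⟨c, hc⟩ := hφ.exists_regression K a
  set Y : Ω → ℝ := fun ω => ∑ b ∈ K, c b * φ b ω with hY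
  have hYL : MemLp Y 2 P := memLp_finsetSum _ fun b _ => (hφ.memLp b).const_mul (c b)
  have hYm : Measurable Y := Finset.measurable_sum _ fun b _ => (hφ.1 b).const_mul _
  have hφY : ∀ γ, ∫ ω, Y ω * φ γ ω ∂P = ∑ b ∈ K, c b * green d b γ := fun γ => by
    simp only [hY, Finset.sum_mul]
    rw [integral_finsetSum]
    · refine Finset.sum_congr rfl fun b _ => ?_
      simp only [mul_assoc]
      rw [integral_const_mul, hφ.integral_mul]
    · intro b _
      simp only [mul_assoc]
      exact ((hφ.memLp b).integrable_mul (hφ.memLp γ)).const_mul _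
  have hYY : ∫ ω, Y ω ^ 2 ∂P = ∑ b ∈ K, c b * green d b a := by
    have e : (fun ω => Y ω ^ 2) = fun ω => ∑ γ ∈ K, c γ * (Y ω * φ γ ω) := by
      funext ω
      rw [sq]
      conv_lhs => rw [hY]
      simp only [Finset.sum_mul]
      refine Finset.sum_congr rfl fun γ _ => ?_
      ring
    rw [e, integral_finsetSum]
    · refine Finset.sum_congr rfl fun γ hγ => ?_
      rw [integral_const_mul, hφY, hc γ hγ, green_symm]
    · exact fun γ _ => (hYL.integrable_mul (hφ.memLp γ)).const_mul _
  have hYK : ∑ b ∈ K, ∑ b' ∈ K, c b * c b' * green d b b' = ∑ b ∈ K, c b * green d b a := by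
    rw [Finset.sum_comm]
    refine Finset.sum_congr rfl fun γ hγ => ?_
    rw [green_symm d γ a, ← hc γ hγ, Finset.mul_sum]
    exact Finset.sum_congr rfl fun b _ => by ring
  have h0 : 0 ≤ ∑ b ∈ K, c b * green d b a := hYY ▸ integral_nonneg fun ω => sq_nonneg _
  have hle := two_mul_sum_green_le hd K c a hM hK
  rw [hYK] at hle
  have hjoint := hφ.hasGaussianLaw_sub_linComb K a c
  set ψ : Ω → ℝ := fun ω => φ a ω - Y ω with hψ
  have hψL : MemLp ψ 2 P := (hφ.memLp a).sub hYL
  have hψφ : ∀ γ, ∫ ω, ψ ω * φ γ ω ∂P = green d a γ - ∑ b ∈ K, c b * green d b γ := fun γ => by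
    simp only [hψ, sub_mul]
    have h1 : Integrable (fun ω => φ a ω * φ γ ω) P := (hφ.memLp a).integrable_mul (hφ.memLp γ)
    have h2 : Integrable (fun ω => Y ω * φ γ ω) P := hYL.integrable_mul (hφ.memLp γ)
    rw [integral_sub h1 h2, hφ.integral_mul, hφY]
  have hY0 : ∫ ω, Y ω ∂P = 0 := by
    simp only [hY]
    rw [integral_finsetSum]
    · exact Finset.sum_eq_zero fun b _ => by
        rw [integral_const_mul, hφ.integral_eq_zero, mul_zero]
    · exact fun b _ => ((hφ.memLp b).integrable one_le_two).const_mul _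
  have hψ0 : ∫ ω, ψ ω ∂P = 0 := by
    simp only [hψ]
    rw [integral_sub ((hφ.memLp a).integrable one_le_two) (hYL.integrable one_le_two),
      hφ.integral_eq_zero, hY0, sub_zero]
  have hψY : ∫ ω, ψ ω * Y ω ∂P = 0 := by
    have e : (fun ω => ψ ω * Y ω) = fun ω => ∑ γ ∈ K, c γ * (ψ ω * φ γ ω) := by
      funext ω
      simp only [hY, Finset.mul_sum]
      refine Finset.sum_congr rfl fun γ _ => ?_
      ring
    rw [e, integral_finsetSum]
    · exact Finset.sum_eq_zero fun γ hγ => by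
        rw [integral_const_mul, hψφ, hc γ hγ, sub_self, mul_zero]
    · exact fun γ _ => (hψL.integrable_mul (hφ.memLp γ)).const_mul _
  have hψψ : Var[ψ; P] = green d 0 0 - ∑ b ∈ K, c b * green d b a := by
    have h1 : Integrable (fun ω => ψ ω * φ a ω) P := hψL.integrable_mul (hφ.memLp a)
    have h2 : Integrable (fun ω => ψ ω * Y ω) P := hψL.integrable_mul hYL
    rw [variance_of_integral_eq_zero hψL.1.aemeasurable hψ0, ← green_self d a, ← hψφ a,
      ← sub_zero (∫ ω, ψ ω * φ a ω ∂P), ← hψY,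
      ← integral_sub h1 h2]
    refine integral_congr_ae (.of_forall fun ω => ?_)
    simp only [hψ]
    ring
  refine ⟨c, _, h0, by linarith, hYY, ?_, ?_⟩
  · rw [(hjoint.snd.eval ()).map_eq_gaussianReal, ← hψψ]
    change gaussianReal (∫ ω, ψ ω ∂P) _ = _
    rw [hψ0]
  · have := hjoint.indepFun_of_covariance_eval (X := fun (b : K) ω => φ b ω)
      (Y := fun (_ : Unit) ω => ψ ω) fun b _ => by
        rw [covariance_eq_sub (hφ.memLp b) hψL, hψ0, mul_zero, sub_zero]
        simp only [Pi.mul_apply, mul_comm (φ b _)]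
        rw [hψφ, hc b b.2, sub_self]
    exact this.comp measurable_id (measurable_pi_apply ())

end Regression

section GaussianComparison

lemma exp_mul_gaussianPDFReal_le {s g v M x y : ℝ} (hs : 1 / 2 ≤ s) (hsg : s ≤ g) (hg : 1 ≤ g)
    (hM : g - s ≤ M) (hx : |x| ≤ v) :
    exp (-(v ^ 2 * M + 2 * v * |y| + y ^ 2)) * gaussianPDFReal 0 g.toNNReal x ≤
      gaussianPDFReal y s.toNNReal x := by
  have hs0 : 0 < s := by linarith
  have hg0 : 0 < g := by linarith
  have hv : 0 ≤ v := (abs_nonneg x).trans hx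
  simp only [gaussianPDFReal, Real.coe_toNNReal _ hs0.le, Real.coe_toNNReal _ hg0.le, sub_zero]
  rw [mul_left_comm, ← Real.exp_add]
  gcongr
  have hx2 : x ^ 2 ≤ v ^ 2 := sq_le_sq' (by linarith [neg_abs_le x]) ((le_abs_self x).trans hx)
  have h1 : x ^ 2 / (2 * s) - x ^ 2 / (2 * g) ≤ v ^ 2 * M := by
    have e : x ^ 2 / (2 * s) - x ^ 2 / (2 * g) = x ^ 2 * ((g - s) / (2 * s * g)) := by
      field_simp
    rw [e]
    refine mul_le_mul hx2 ?_ (div_nonneg (by linarith) (by positivity)) (sq_nonneg v)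
    refine (div_le_self (by linarith) ?_).trans hM
    nlinarith
  have h2 : -(x * y) / s ≤ 2 * v * |y| := by
    rw [div_le_iff₀ hs0]
    have : -(x * y) ≤ v * |y| := (neg_le_abs _).trans
      (by rw [abs_mul]; exact mul_le_mul_of_nonneg_right hx (abs_nonneg y))
    nlinarith [mul_nonneg hv (abs_nonneg y)]
  have h3 : y ^ 2 / (2 * s) ≤ y ^ 2 := div_le_self (sq_nonneg y) (by linarith)
  have e : -(x - y) ^ 2 / (2 * s) = -(x ^ 2 / (2 * s)) - (-(x * y) / s) - y ^ 2 / (2 * s) := by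
    field_simp
    ring
  rw [e, neg_div]
  linarith

lemma exp_mul_gaussianReal_le {s g v M y : ℝ} (hs : 1 / 2 ≤ s) (hsg : s ≤ g) (hg : 1 ≤ g)
    (hM : g - s ≤ M) {T : Set ℝ} (hTv : ∀ x ∈ T, |x| ≤ v) :
    ENNReal.ofReal (exp (-(v ^ 2 * M + 2 * v * |y| + y ^ 2))) * gaussianReal 0 g.toNNReal T ≤
      gaussianReal y s.toNNReal T := by
  rw [gaussianReal_apply _ (by simp; linarith), gaussianReal_apply _ (by simp; linarith),
    ← lintegral_const_mul _ (measurable_gaussianPDF _ _)]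
  refine setLIntegral_mono (measurable_gaussianPDF _ _) fun x hx => ?_
  rw [gaussianPDF, gaussianPDF, ← ENNReal.ofReal_mul (exp_pos _).le]
  exact ENNReal.ofReal_le_ofReal (exp_mul_gaussianPDFReal_le hs hsg hg hM (hTv x hx))

variable {Ω E : Type*} [MeasurableSpace Ω] {P : Measure Ω} [IsProbabilityMeasure P]
  [MeasurableSpace E]

lemma IndepFun.gaussianReal_mul_le {X : Ω → E} {ψ : Ω → ℝ} {h : E → ℝ} {s g v M : ℝ}
    (hX : Measurable X) (hψ : Measurable ψ) (hh : Measurable h) (hind : IndepFun X ψ P)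
    (hlaw : P.map ψ = gaussianReal 0 s.toNNReal) (hL : MemLp (fun ω => h (X ω)) 2 P)
    (hs : 1 / 2 ≤ s) (hsg : s ≤ g) (hg : 1 ≤ g) (hM : g - s ≤ M) (hv : 0 ≤ v)
    {T : Set ℝ} (hT : MeasurableSet T) (hTv : ∀ x ∈ T, |x| ≤ v)
    {B : Set E} (hB : MeasurableSet B) :
    (gaussianReal 0 g.toNNReal).real T *
        (P.real (X ⁻¹' B) - ∫ ω, (v ^ 2 * M + 2 * v * |h (X ω)| + h (X ω) ^ 2) ∂P) ≤
      P.real (X ⁻¹' B ∩ {ω | h (X ω) + ψ ω ∈ T}) := by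
  set A : Ω → ℝ := fun ω => v ^ 2 * M + 2 * v * |h (X ω)| + h (X ω) ^ 2 with hA
  have hM0 : 0 ≤ M := by linarith
  have hA0 : ∀ ω, 0 ≤ A ω := fun ω => by simp only [hA]; positivity
  have hAm : Measurable A := by fun_prop
  have hAi : Integrable A P := by
    refine Integrable.add (Integrable.add (integrable_const _) ?_) hL.integrable_sq
    exact ((hL.integrable one_le_two).abs).const_mul _
  have hei : Integrable (fun ω => exp (-A ω)) P := by
    refine Integrable.mono' (integrable_const (1 : ℝ)) (by fun_prop) (.of_forall fun ω => ?_)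
    rw [Real.norm_eq_abs, abs_of_pos (exp_pos _)]
    exact exp_le_one_iff.2 (by linarith [hA0 ω])
  have hS : MeasurableSet (X ⁻¹' B) := hX hB
  have hD : MeasurableSet {q : E × ℝ | q.1 ∈ B ∧ h q.1 + q.2 ∈ T} :=
    (measurable_fst hB).inter (((hh.comp measurable_fst).add measurable_snd) hT)
  have key : P (X ⁻¹' B ∩ {ω | h (X ω) + ψ ω ∈ T}) =
      ∫⁻ ω in X ⁻¹' B, gaussianReal (h (X ω)) s.toNNReal T ∂P := by
    have h1 : P (X ⁻¹' B ∩ {ω | h (X ω) + ψ ω ∈ T}) =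
        P.map (fun ω => (X ω, ψ ω)) {q : E × ℝ | q.1 ∈ B ∧ h q.1 + q.2 ∈ T} := by
      rw [Measure.map_apply (hX.prodMk hψ) hD]
      rfl
    rw [h1, (indepFun_iff_map_prod_eq_prod_map_map hX.aemeasurable hψ.aemeasurable).1 hind,
      Measure.prod_apply hD, hlaw, lintegral_map (measurable_measure_prodMk_left hD) hX,
      ← lintegral_indicator hS]
    refine lintegral_congr fun ω => ?_
    by_cases hω : X ω ∈ B
    · rw [indicator_of_mem (by exact hω)]
      have : gaussianReal (h (X ω)) s.toNNReal =
          (gaussianReal 0 s.toNNReal).map (h (X ω) + ·) := by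
        rw [gaussianReal_map_const_add, zero_add]
      rw [this, Measure.map_apply (by fun_prop) hT]
      congr 1
      ext w
      simp [hω]
    · rw [indicator_of_notMem (by exact hω)]
      simp [hω]
  have h2 : ENNReal.ofReal ((gaussianReal 0 g.toNNReal).real T *
      ∫ ω in X ⁻¹' B, exp (-A ω) ∂P) ≤ P (X ⁻¹' B ∩ {ω | h (X ω) + ψ ω ∈ T}) := by
    rw [key, ENNReal.ofReal_mul measureReal_nonneg, ofReal_measureReal,
      ofReal_integral_eq_lintegral_ofReal hei.integrableOn (.of_forall fun ω => (exp_pos _).le),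
      ← lintegral_const_mul _ (by fun_prop)]
    refine lintegral_mono fun ω => ?_
    rw [mul_comm]
    exact exp_mul_gaussianReal_le hs hsg hg hM hTv
  have h3 := (ENNReal.ofReal_le_iff_le_toReal (measure_ne_top _ _)).1 h2
  refine le_trans (mul_le_mul_of_nonneg_left ?_ measureReal_nonneg) h3
  have h4 : ∫ ω in X ⁻¹' B, (1 - A ω) ∂P ≤ ∫ ω in X ⁻¹' B, exp (-A ω) ∂P :=
    setIntegral_mono ((integrable_const _).sub hAi).integrableOn hei.integrableOn
      fun ω => by linarith [add_one_le_exp (-A ω)]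
  have h5 : ∫ ω in X ⁻¹' B, A ω ∂P ≤ ∫ ω, A ω ∂P :=
    setIntegral_le_integral hAi (.of_forall hA0)
  rw [integral_sub (integrable_const _) hAi.integrableOn, setIntegral_const, smul_eq_mul,
    mul_one] at h4
  linarith

end GaussianComparison

section CondExp

variable {Ω : Type*} {m m0 : MeasurableSpace Ω} {P : Measure Ω} [IsProbabilityMeasure P]

/-- If an event is almost independent (from below) of each event of `m`, then its conditional
probability given `m` is close in `L¹` to its probability. -/
lemma integral_abs_condExp_indicator_sub_le (hm : m ≤ m0) {E : Set Ω}
    (hE : MeasurableSet E) {δ : ℝ}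
    (h : ∀ S, MeasurableSet[m] S → P.real E * P.real S - P.real (S ∩ E) ≤ δ) :
    ∫ ω, |(P[E.indicator fun _ => (1 : ℝ) | m]) ω - P.real E| ∂P ≤ 2 * δ := by
  set f : Ω → ℝ := P[E.indicator fun _ => (1 : ℝ) | m] with hf
  have hfi : Integrable f P := integrable_condExp
  have hEi : Integrable (E.indicator fun _ => (1 : ℝ)) P := (integrable_const 1).indicator hE
  have hfm : Measurable[m] f := stronglyMeasurable_condExp.measurable
  set D : Set Ω := {ω | f ω < P.real E} with hD
  have hDm : MeasurableSet[m] D := hfm measurableSet_Iio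
  have hDm0 : MeasurableSet D := hm _ hDm
  have hgi : Integrable (fun ω => f ω - P.real E) P := hfi.sub (integrable_const _)
  have h0 : ∫ ω, (f ω - P.real E) ∂P = 0 := by
    rw [integral_sub hfi (integrable_const _), hf, integral_condExp hm,
      integral_indicator_const _ hE]
    simp
  have hDint : ∫ ω in D, f ω ∂P = P.real (D ∩ E) := by
    rw [hf, setIntegral_condExp hm hEi hDm, setIntegral_indicator hE]
    simp
  have e : ∀ ω, |f ω - P.real E| =
      (f ω - P.real E) + 2 * D.indicator (fun ω => P.real E - f ω) ω := fun ω => by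
    by_cases hω : f ω < P.real E
    · rw [indicator_of_mem (by exact hω), abs_of_neg (by linarith)]; ring
    · rw [indicator_of_notMem (by exact hω), abs_of_nonneg (by linarith)]; ring
  simp only [e]
  have hDi : Integrable (fun ω => 2 * D.indicator (fun ω => P.real E - f ω) ω) P :=
    (((integrable_const _).sub hfi).indicator hDm0).const_mul 2
  rw [integral_add hgi hDi, h0,
    integral_const_mul, integral_indicator hDm0,
    integral_sub (integrable_const _) hfi.integrableOn, hDint, setIntegral_const, smul_eq_mul]
  linarith [h D hDm]

end CondExp

section FieldEstimate

variable {Ω : Type*} {m m0 : MeasurableSpace Ω} {P : Measure Ω} {d : ℕ}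
  {φ : Zd d → Ω → ℝ}

lemma IsGaussianField.map_eq (hφ : IsGaussianField P d (green d) φ) (a : Zd d) :
    P.map (φ a) = gaussianReal 0 (green d 0 0).toNNReal := by
  have h := hφ.map_linComb {a} 1
  simpa only [Finset.sum_singleton, Pi.one_apply, one_mul, green_self d a] using h

lemma integral_abs_le_sqrt [IsProbabilityMeasure P] {Y : Ω → ℝ} (hY : MemLp Y 2 P) {M : ℝ} (h : ∫ ω, Y ω ^ 2 ∂P ≤ M) :
    ∫ ω, |Y ω| ∂P ≤ √M := by
  refine Real.le_sqrt_of_sq_le (le_trans ?_ h)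
  have h1 := variance_nonneg (fun ω => |Y ω|) P
  rw [variance_eq_sub (X := fun ω => |Y ω|) hY.abs] at h1
  simpa [Pi.pow_def, sq_abs] using h1

/-- The conditional probability of `φ a ∈ T₀` given events depending on `(φ b)_{b ∈ K}` is close
to its unconditional probability if `φ a` is weakly correlated with each `φ b`, `b ∈ K`. -/
lemma IsGaussianField.integral_abs_condExp_sub_le [IsProbabilityMeasure P] (hd : 3 ≤ d)
    (hφ : IsGaussianField P d (green d) φ) (K : Finset (Zd d)) (a : Zd d) {M v : ℝ}
    (hM : 0 ≤ M) (hM2 : M ≤ 1 / 2) (hv : 0 ≤ v) (hK : ∀ b ∈ K, green d b a ≤ M)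
    {T : Set ℝ} (hT : MeasurableSet T)
    (hm : m ≤ MeasurableSpace.comap (fun ω (b : K) => φ b ω) inferInstance) :
    ∫ ω, |(P[(φ a ⁻¹' T).indicator fun _ => (1 : ℝ) | m]) ω - P.real (φ a ⁻¹' T)| ∂P ≤
      2 * (P.real {ω | v < |φ a ω|} +
        P.real (φ a ⁻¹' T) * (v ^ 2 * M + 2 * v * √M + M)) := by
  have hXm : Measurable (fun ω (b : K) => φ b ω) := measurable_pi_lambda _ fun b => hφ.1 b
  refine integral_abs_condExp_indicator_sub_le (hm.trans hXm.comap_le) (hφ.1 a hT)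
    fun S hS => ?_
  obtain ⟨B, hB, rfl⟩ := hm S hS
  obtain ⟨c, t, ht0, htM, hY2, hlaw, hind⟩ := hφ.exists_decomposition hd K a hM hK
  have hg := one_le_green_zero d hd
  have hh : Measurable (fun x : K → ℝ => ∑ b : K, c b * x b) := by fun_prop
  have hsum : ∀ ω, ∑ b : K, c b * φ b ω = ∑ b ∈ K, c b * φ b ω := fun ω =>
    Finset.sum_coe_sort K fun b => c b * φ b ω
  have hYL : MemLp (fun ω => ∑ b ∈ K, c b * φ b ω) 2 P :=
    memLp_finsetSum _ fun b _ => (hφ.memLp b).const_mul (c b)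
  have hψm : Measurable (fun ω => φ a ω - ∑ b ∈ K, c b * φ b ω) :=
    (hφ.1 a).sub (Finset.measurable_sum _ fun b _ => (hφ.1 b).const_mul _)
  have key := IndepFun.gaussianReal_mul_le (g := green d 0 0) (v := v) (M := M) hXm hψm hh hind
    hlaw (by simpa only [hsum] using hYL) (by linarith) (by linarith) hg (by linarith) hv
    (T := T ∩ {x | |x| ≤ v}) (hT.inter (measurableSet_le (by fun_prop) measurable_const))
    (fun x hx => hx.2) hB
  simp only [hsum, add_sub_cancel] at key
  rw [← hφ.map_eq a, map_measureReal_apply (hφ.1 a)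
    (hT.inter (measurableSet_le (by fun_prop) measurable_const))] at key
  have hint : ∫ ω, (v ^ 2 * M + 2 * v * |∑ b ∈ K, c b * φ b ω| +
      (∑ b ∈ K, c b * φ b ω) ^ 2) ∂P ≤ v ^ 2 * M + 2 * v * √M + M := by
    have h1 : Integrable (fun ω => 2 * v * |∑ b ∈ K, c b * φ b ω|) P :=
      ((hYL.integrable one_le_two).abs).const_mul _
    have h2 : Integrable (fun ω => v ^ 2 * M + 2 * v * |∑ b ∈ K, c b * φ b ω|) P :=
      (integrable_const _).add h1
    rw [integral_add h2 hYL.integrable_sq,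
      integral_add (integrable_const _) h1, integral_const_mul (2 * v), hY2]
    have h3 := integral_abs_le_sqrt hYL (hY2.trans_le htM)
    have h4 := mul_le_mul_of_nonneg_left h3 (by positivity : 0 ≤ 2 * v)
    simp only [integral_const, probReal_univ, smul_eq_mul, one_mul]
    linarith
  set EA := v ^ 2 * M + 2 * v * √M + M with hEA
  have hEA0 : 0 ≤ EA := by positivity
  set pT := P.real (φ a ⁻¹' (T ∩ {x | |x| ≤ v})) with hpT
  have hpT0 : 0 ≤ pT := measureReal_nonneg
  have hle : pT ≤ P.real (φ a ⁻¹' T) := measureReal_mono (fun ω hω => hω.1)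
  have hge : P.real (φ a ⁻¹' T) ≤ pT + P.real {ω | v < |φ a ω|} := by
    refine (measureReal_mono fun ω hω => ?_).trans (measureReal_union_le _ _)
    rcases le_or_gt (|φ a ω|) v with h | h
    · exact Or.inl ⟨hω, h⟩
    · exact Or.inr h
  set S : Set Ω := (fun ω (b : K) => φ b ω) ⁻¹' B with hSdef
  have hS1 : P.real S ≤ 1 := measureReal_le_one
  have hS0 : 0 ≤ P.real S := measureReal_nonneg
  have hq0 : 0 ≤ P.real {ω | v < |φ a ω|} := measureReal_nonneg
  have hfin : P.real (S ∩ {ω | φ a ω ∈ T ∩ {x | |x| ≤ v}}) ≤ P.real (S ∩ φ a ⁻¹' T) :=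
    measureReal_mono fun ω hω => ⟨hω.1, hω.2.1⟩
  have h1 := mul_le_mul_of_nonneg_right hge hS0
  have h2 := mul_le_mul_of_nonneg_left hS1 hq0
  have h3 := mul_le_mul_of_nonneg_left hint hpT0
  have h4 := mul_le_mul_of_nonneg_right hle hEA0
  rw [mul_sub] at key
  linarith

end FieldEstimate

section SumEstimate

lemma IsFiniteUnionIocFrom.measurableSet {z : ℝ} {R : Set EReal} (h : IsFiniteUnionIocFrom z R) :
    MeasurableSet R := by
  obtain ⟨m, w, r, -, -, -, rfl⟩ := h
  exact MeasurableSet.iUnion fun l => measurableSet_Ioc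

lemma IsFiniteUnionIocFrom.lt_of_mem {z : ℝ} {R : Set EReal} (h : IsFiniteUnionIocFrom z R)
    {x : ℝ} (hx : (x : EReal) ∈ R) : z < x := by
  obtain ⟨m, w, r, hw, -, -, rfl⟩ := h
  obtain ⟨l, hl⟩ := mem_iUnion.1 hx
  exact (hw l).trans_lt (EReal.coe_lt_coe_iff.1 hl.1)

/-- The values of `φ a` for which `X_a = 1`. -/
def exceedSet (d n k : ℕ) (lo hi : Fin k → Fin d → ℝ) (R : Fin k → Set EReal) (a : Zd d) :
    Set ℝ :=
  {x | ∃ j, a ∈ rectIdx d n (lo j) (hi j) ∧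
    (((x - bN (green d 0 0) (n ^ d)) / aN (green d 0 0) (n ^ d) : ℝ) : EReal) ∈ R j}

variable {d n k : ℕ} {lo hi : Fin k → Fin d → ℝ} {R : Fin k → Set EReal} {z : ℝ}

lemma measurableSet_exceedSet (hR : ∀ j, IsFiniteUnionIocFrom z (R j)) (a : Zd d) :
    MeasurableSet (exceedSet d n k lo hi R a) := by
  have : exceedSet d n k lo hi R a = ⋃ j, {x | a ∈ rectIdx d n (lo j) (hi j)} ∩
      (fun x : ℝ => (((x - bN (green d 0 0) (n ^ d)) / aN (green d 0 0) (n ^ d) : ℝ) : EReal))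
        ⁻¹' R j := by
    ext x
    simp [exceedSet]
  rw [this]
  exact MeasurableSet.iUnion fun j => (MeasurableSet.const _).inter
    ((measurable_coe_real_ereal.comp (by fun_prop)) (hR j).measurableSet)

lemma exceedSet_subset (hR : ∀ j, IsFiniteUnionIocFrom z (R j))
    (ha : 0 < aN (green d 0 0) (n ^ d)) (a : Zd d) :
    exceedSet d n k lo hi R a ⊆ Ioi (uN (green d 0 0) (n ^ d) z) := by
  rintro x ⟨j, -, hj⟩
  have h := (hR j).lt_of_mem hj
  rw [lt_div_iff₀ ha] at h
  rw [mem_Ioi, uN]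
  linarith

lemma stX_eq {Ω : Type*} [MeasurableSpace Ω] (φ : Zd d → Ω → ℝ) (a : Zd d) :
    stX d n k lo hi R φ a =
      (φ a ⁻¹' exceedSet d n k lo hi R a).indicator fun _ => (1 : ℝ) := by
  classical
  funext ω
  rw [indicator_apply]
  exact if_congr Iff.rfl rfl rfl

lemma setOf_stX_eq_one {Ω : Type*} [MeasurableSpace Ω] (φ : Zd d → Ω → ℝ) (a : Zd d) :
    {ω | stX d n k lo hi R φ a ω = 1} = φ a ⁻¹' exceedSet d n k lo hi R a := by
  classical
  ext ω
  rw [mem_ofPred_eq, stX_eq, indicator_apply]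
  split_ifs with h <;> simp only [h, zero_ne_one]

lemma stSigma_le {Ω : Type*} [MeasurableSpace Ω] (φ : Zd d → Ω → ℝ)
    (hR : ∀ j, IsFiniteUnionIocFrom z (R j)) (ε : ℝ) (a : Zd d) :
    stSigma d n k ε lo hi R φ a ≤ MeasurableSpace.comap
      (fun ω (b : (stIdx d n k lo hi \ stB d n k ε lo hi a : Finset (Zd d))) => φ b ω)
      inferInstance := by
  refine iSup₂_le fun b hb => Measurable.comap_le ?_
  have e : stX d n k lo hi R φ b =
      (fun x : (stIdx d n k lo hi \ stB d n k ε lo hi a : Finset (Zd d)) → ℝ =>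
        (exceedSet d n k lo hi R b).indicator (fun _ => (1 : ℝ)) (x ⟨b, hb⟩)) ∘
      fun ω b => φ b ω := by
    rw [stX_eq]
    rfl
  rw [e]
  refine Measurable.comp ?_ (comap_measurable _)
  exact (measurable_const.indicator (measurableSet_exceedSet hR b)).comp (measurable_pi_apply _)

lemma card_stIdx_le (d n k : ℕ) (lo hi : Fin k → Fin d → ℝ) :
    (stIdx d n k lo hi).card ≤ n ^ d := by
  classical
  have hsub : stIdx d n k lo hi ⊆ VN d n :=
    Finset.biUnion_subset.2 fun j _ => Finset.filter_subset _ _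
  refine (Finset.card_le_card hsub).trans (le_of_eq ?_)
  simp [VN]

lemma sum_integral_abs_condExp_sub_le (hd : 3 ≤ d) {Ω : Type*} [MeasurableSpace Ω]
    (P : Measure Ω) [IsProbabilityMeasure P] (φ : Zd d → Ω → ℝ)
    (hφ : IsGaussianField P d (green d) φ) (hR : ∀ j, IsFiniteUnionIocFrom z (R j))
    (ε : ℝ) (ha : 0 < aN (green d 0 0) (n ^ d)) {M v : ℝ}
    (hM : 0 ≤ M) (hM2 : M ≤ 1 / 2) (hv : 0 ≤ v)
    (hgM : ∀ a b : Zd d, Real.log ((n ^ d : ℕ) : ℝ) ^ (2 + 2 * ε) < distInf d a b →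
      green d a b ≤ M) :
    ∑ a ∈ stIdx d n k lo hi,
      ∫ ω, |(P[stX d n k lo hi R φ a | stSigma d n k ε lo hi R φ a]) ω
              - (P {ω' | stX d n k lo hi R φ a ω' = 1}).toReal| ∂P ≤
    ((n ^ d : ℕ) : ℝ) * (2 * ((gaussianReal 0 (green d 0 0).toNNReal).real {x | v < |x|} +
      (gaussianReal 0 (green d 0 0).toNNReal).real (Ioi (uN (green d 0 0) (n ^ d) z)) *
        (v ^ 2 * M + 2 * v * √M + M))) := by
  classical
  set C := 2 * ((gaussianReal 0 (green d 0 0).toNNReal).real {x | v < |x|} +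
      (gaussianReal 0 (green d 0 0).toNNReal).real (Ioi (uN (green d 0 0) (n ^ d) z)) *
        (v ^ 2 * M + 2 * v * √M + M)) with hC
  have hEA : 0 ≤ v ^ 2 * M + 2 * v * √M + M := by positivity
  have hC0 : 0 ≤ C := by positivity
  refine (Finset.sum_le_card_nsmul _ _ C fun a _ => ?_).trans ?_
  · rw [setOf_stX_eq_one, stX_eq]
    refine (hφ.integral_abs_condExp_sub_le hd
      (stIdx d n k lo hi \ stB d n k ε lo hi a) a hM hM2 hv (fun b hb => hgM b a ?_)
      (measurableSet_exceedSet hR a) (stSigma_le φ hR ε a)).trans ?_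
    · rw [stB, Finset.mem_sdiff, Finset.mem_filter, not_and, not_le] at hb
      exact hb.2 hb.1
    · rw [hC, ← hφ.map_eq a, map_measureReal_apply (hφ.1 a) measurableSet_Ioi,
        map_measureReal_apply (hφ.1 a) (measurableSet_lt measurable_const (by fun_prop))]
      have h : P.real (φ a ⁻¹' exceedSet d n k lo hi R a) ≤
          P.real (φ a ⁻¹' Ioi (uN (green d 0 0) (n ^ d) z)) :=
        measureReal_mono (preimage_mono (exceedSet_subset hR ha a))
      have h' := mul_le_mul_of_nonneg_right h hEA
      exact mul_le_mul_of_nonneg_left (add_le_add le_rfl h') zero_le_two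
  · rw [nsmul_eq_mul]
    exact mul_le_mul_of_nonneg_right (Nat.cast_le.2 (card_stIdx_le d n k lo hi)) hC0

end SumEstimate

section GaussianTail

variable {g u : ℝ}

lemma gaussianReal_real_Ioi_le (hg : 0 < g) (hu : 0 < u) :
    (gaussianReal 0 g.toNNReal).real (Ioi u) ≤
      (√(2 * π * g))⁻¹ * (g / u * exp (-u ^ 2 / (2 * g))) := by
  have hne : g.toNNReal ≠ 0 := by simpa using hg
  have hug : -(u / g) < 0 := neg_lt_zero.2 (div_pos hu hg)
  have hint : IntegrableOn (fun x => exp (-(u / g) * x)) (Ioi u) := integrableOn_exp_mul_Ioi hug u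
  rw [measureReal_def, gaussianReal_apply_eq_integral _ hne,
    ENNReal.toReal_ofReal (integral_nonneg fun x => gaussianPDFReal_nonneg _ _ _)]
  have hle : ∀ x, gaussianPDFReal 0 g.toNNReal x ≤
      (√(2 * π * g))⁻¹ * exp (u ^ 2 / (2 * g)) * exp (-(u / g) * x) := fun x => by
    rw [gaussianPDFReal, Real.coe_toNNReal _ hg.le, sub_zero, mul_assoc (√(2 * π * g))⁻¹,
      ← Real.exp_add]
    gcongr
    have : u ^ 2 / (2 * g) + -(u / g) * x - -x ^ 2 / (2 * g) = (x - u) ^ 2 / (2 * g) := by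
      field_simp
      ring
    have h2 : 0 ≤ (x - u) ^ 2 / (2 * g) := by positivity
    linarith
  refine (setIntegral_mono (integrable_gaussianPDFReal 0 _).integrableOn (hint.const_mul _)
    hle).trans (le_of_eq ?_)
  rw [integral_const_mul, integral_exp_mul_Ioi hug, neg_div_neg_eq, mul_assoc]
  have e : exp (-u ^ 2 / (2 * g)) = exp (u ^ 2 / (2 * g)) * exp (-(u / g) * u) := by
    rw [← Real.exp_add]
    congr 1
    field_simp
    ring
  rw [e]
  field_simp

lemma gaussianReal_real_abs_le (hg : 0 < g) (hu : 0 < u) :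
    (gaussianReal 0 g.toNNReal).real {x | u < |x|} ≤
      2 * ((√(2 * π * g))⁻¹ * (g / u * exp (-u ^ 2 / (2 * g)))) := by
  have hsub : {x : ℝ | u < |x|} ⊆ Ioi u ∪ (fun x => -x) ⁻¹' Ioi u := fun x hx => by
    rcases lt_abs.1 (show u < |x| from hx) with h | h
    exacts [Or.inl h, Or.inr h]
  have hsymm : (gaussianReal 0 g.toNNReal).real ((fun x => -x) ⁻¹' Ioi u) =
      (gaussianReal 0 g.toNNReal).real (Ioi u) := by
    rw [← map_measureReal_apply measurable_neg measurableSet_Ioi, gaussianReal_map_neg, neg_zero]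
  have h1 := (measureReal_mono hsub).trans
    (measureReal_union_le (μ := gaussianReal 0 g.toNNReal) _ _)
  linarith [gaussianReal_real_Ioi_le hg hu]

end GaussianTail

section Scaling

variable {g : ℝ}

lemma tendsto_log_natCast_atTop : Tendsto (fun N : ℕ => Real.log (N : ℝ)) atTop atTop :=
  tendsto_log_atTop.comp tendsto_natCast_atTop_atTop

lemma eventually_natCast_mul_gaussianReal_abs_le (hg : 1 ≤ g) :
    ∀ᶠ N : ℕ in atTop, (N : ℝ) * (gaussianReal 0 g.toNNReal).real
      {x | 2 * √(g * Real.log N) < |x|} ≤ 2 * g * (N : ℝ)⁻¹ := by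
  filter_upwards [tendsto_log_natCast_atTop.eventually_ge_atTop 1, eventually_gt_atTop 0]
    with N hL hN
  set L := Real.log (N : ℝ) with hLdef
  have hN' : (0 : ℝ) < N := Nat.cast_pos.2 hN
  have hg0 : 0 < g := by linarith
  have hgL : 1 ≤ √(g * L) := Real.one_le_sqrt.2 (by nlinarith)
  have h := gaussianReal_real_abs_le hg0 (u := 2 * √(g * L)) (by linarith)
  have he : exp (-(2 * √(g * L)) ^ 2 / (2 * g)) = (N : ℝ)⁻¹ * (N : ℝ)⁻¹ := by
    rw [mul_pow, Real.sq_sqrt (by positivity)]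
    have : -(2 ^ 2 * (g * L)) / (2 * g) = -L + -L := by field_simp; ring
    rw [this, Real.exp_add, Real.exp_neg, hLdef, Real.exp_log hN']
  have h1 : (√(2 * π * g))⁻¹ ≤ 1 := inv_le_one_of_one_le₀
    (Real.one_le_sqrt.2 (by nlinarith [pi_gt_three]))
  have h2 : g / (2 * √(g * L)) ≤ g := div_le_self hg0.le (by linarith)
  have h3 : (√(2 * π * g))⁻¹ * (g / (2 * √(g * L)) * ((N : ℝ)⁻¹ * (N : ℝ)⁻¹)) ≤
      1 * (g * ((N : ℝ)⁻¹ * (N : ℝ)⁻¹)) := by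
    gcongr
  rw [he] at h
  calc (N : ℝ) * _ ≤ N * (2 * (1 * (g * ((N : ℝ)⁻¹ * (N : ℝ)⁻¹)))) := by gcongr; linarith
    _ = 2 * g * (N : ℝ)⁻¹ := by field_simp

lemma eventually_bN_pos_and_tail_le (hg : 1 ≤ g) (z : ℝ) :
    ∀ᶠ N : ℕ in atTop, 0 < bN g N ∧
      (N : ℝ) * (gaussianReal 0 g.toNNReal).real (Ioi (uN g N z)) ≤ 4 * exp (-z) := by
  have hg0 : 0 < g := by linarith
  have hlog : ∀ᶠ L : ℝ in atTop, Real.log L + Real.log (4 * π) ≤ 2 * L := by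
    have h1 := isLittleO_log_id_atTop.bound (c := 1) one_pos
    filter_upwards [h1, eventually_ge_atTop (Real.log (4 * π)), eventually_ge_atTop 0]
      with L h1 h2 h3
    simp only [id, Real.norm_eq_abs, one_mul, abs_of_nonneg h3] at h1
    linarith [le_abs_self (Real.log L)]
  filter_upwards [tendsto_log_natCast_atTop.eventually hlog,
    tendsto_log_natCast_atTop.eventually_ge_atTop 1,
    tendsto_log_natCast_atTop.eventually_ge_atTop (4 * |z|), eventually_gt_atTop 0]
    with N h1 h2 h3 hN
  have hN' : (0 : ℝ) < N := Nat.cast_pos.2 hN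
  set L := Real.log (N : ℝ) with hL
  set ℓ := Real.log L + Real.log (4 * π) with hℓ
  set s := √(2 * L) with hs
  have hL0 : 0 < L := by linarith
  have hs2 : s ^ 2 = 2 * L := Real.sq_sqrt (by linarith)
  have hs0 : 0 < s := Real.sqrt_pos.2 (by linarith)
  have hb : bN g N = √g * (s - ℓ / (2 * s)) := rfl
  have hG0 : 0 < √g := Real.sqrt_pos.2 hg0
  have hG2 : √g ^ 2 = g := Real.sq_sqrt hg0.le
  have hq : ℓ / (2 * s) ≤ s / 2 := by
    rw [div_le_iff₀ (by positivity)]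
    nlinarith
  set b := bN g N with hbdef
  have hbs : √g * s / 2 ≤ b := by
    rw [hb, mul_div_assoc]
    exact mul_le_mul_of_nonneg_left (by linarith) hG0.le
  have hb0 : 0 < b := lt_of_lt_of_le (by positivity) hbs
  refine ⟨hb0, ?_⟩
  have hbsq : 2 * g * L - g * ℓ ≤ b ^ 2 := by
    have e : b ^ 2 = g * (s ^ 2 - ℓ + (ℓ / (2 * s)) ^ 2) := by
      rw [hb, mul_pow, hG2]
      field_simp
      ring
    rw [e, hs2]
    nlinarith [mul_nonneg hg0.le (sq_nonneg (ℓ / (2 * s)))]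
  have hu : uN g N z = g / b * z + b := rfl
  set u := uN g N z with hudef
  have hub : b / 2 ≤ u := by
    have : -(b / 2) ≤ g / b * z := by
      rw [div_mul_eq_mul_div, le_div_iff₀ hb0]
      have h5 : g * L / 2 ≤ b ^ 2 := by
        have := mul_self_le_mul_self (by positivity) hbs
        nlinarith
      have h6 := neg_abs_le z
      nlinarith
    linarith
  have hus : √g * s / 4 ≤ u := by linarith
  have hu0 : 0 < u := lt_of_lt_of_le (by positivity) hus
  have husq : L - ℓ / 2 + z ≤ u ^ 2 / (2 * g) := by
    rw [le_div_iff₀ (by positivity)]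
    have e : u ^ 2 = b ^ 2 + 2 * g * z + (g / b * z) ^ 2 := by
      rw [hu]
      field_simp
      ring
    nlinarith [sq_nonneg (g / b * z)]
  have hexp : exp (-u ^ 2 / (2 * g)) ≤ exp (-z) * (N : ℝ)⁻¹ * √(4 * π * L) := by
    have e : exp (-z) * (N : ℝ)⁻¹ * √(4 * π * L) = exp (-(L - ℓ / 2 + z)) := by
      rw [Real.sqrt_eq_rpow, Real.rpow_def_of_pos (by positivity),
        Real.log_mul (by positivity) hL0.ne', ← Real.exp_log hN', ← Real.exp_neg, ← Real.exp_add,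
        ← Real.exp_add, ← hL, hℓ]
      congr 1
      ring
    rw [e, neg_div]
    exact exp_le_exp.2 (neg_le_neg husq)
  have htail := gaussianReal_real_Ioi_le hg0 hu0
  have hgu : g / u ≤ g / (√g * s / 4) := by gcongr
  calc (N : ℝ) * (gaussianReal 0 g.toNNReal).real (Ioi u)
      ≤ N * ((√(2 * π * g))⁻¹ * (g / (√g * s / 4) *
          (exp (-z) * (N : ℝ)⁻¹ * √(4 * π * L)))) := by
        refine mul_le_mul_of_nonneg_left (htail.trans ?_) hN'.le
        gcongr
    _ = 4 * exp (-z) := by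
        have e : √(4 * π * L) = √(2 * π) * s := by
          rw [hs, ← Real.sqrt_mul (by positivity)]
          congr 1
          ring
        have hp : 0 < √(2 * π) := Real.sqrt_pos.2 (by positivity)
        rw [e, Real.sqrt_mul (by positivity) g]
        field_simp
        rw [hG2]

end Scaling

/-- Decay of the Green's function beyond distance `ℓ`, with real `ℓ ≥ 1`. -/
lemma exists_green_le_rpow (d : ℕ) (hd : 3 ≤ d) :
    ∃ C, 0 < C ∧ ∀ (ε L : ℝ), 0 < ε → 1 ≤ L → ∀ a b : Zd d,
      L ^ (2 + 2 * ε) < distInf d a b → green d a b ≤ C * L ^ (-(1 + ε)) := by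
  obtain ⟨C, hC, h⟩ := exists_green_le d hd
  refine ⟨2 * C, by positivity, fun ε L hε hL a b hab => ?_⟩
  have hL0 : 0 < L := by linarith
  set x := L ^ (2 + 2 * ε) with hx
  have hx1 : 1 ≤ x := Real.one_le_rpow hL (by linarith)
  have hf1 : 1 ≤ ⌊x⌋₊ := Nat.one_le_floor_iff x |>.2 hx1
  have hfle : (⌊x⌋₊ : ℝ) ≤ x := Nat.floor_le (by linarith)
  have hflt : x < ⌊x⌋₊ + 1 := Nat.lt_floor_add_one x
  have hf1' : (1 : ℝ) ≤ ⌊x⌋₊ := by exact_mod_cast hf1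
  refine (h ⌊x⌋₊ hf1 a b (hfle.trans_lt hab)).trans ?_
  have hs : √x = L ^ (1 + ε) := by
    rw [Real.sqrt_eq_rpow, hx, ← Real.rpow_mul hL0.le]
    congr 1
    ring
  have hle : L ^ (1 + ε) / 2 ≤ √⌊x⌋₊ := by
    rw [← hs]
    refine Real.le_sqrt_of_sq_le ?_
    rw [div_pow, Real.sq_sqrt (by linarith)]
    linarith
  have hp : 0 < L ^ (1 + ε) := Real.rpow_pos_of_pos hL0 _
  rw [Real.rpow_neg hL0.le]
  calc C * (√⌊x⌋₊)⁻¹ ≤ C * (L ^ (1 + ε) / 2)⁻¹ := by gcongr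
    _ = 2 * C * (L ^ (1 + ε))⁻¹ := by rw [inv_div]; ring

lemma tendsto_error_term {g C ε : ℝ} (hg : 0 < g) (hε : 0 < ε) :
    Tendsto (fun L : ℝ => (2 * √(g * L)) ^ 2 * (C * L ^ (-(1 + ε))) +
      2 * (2 * √(g * L)) * √(C * L ^ (-(1 + ε))) + C * L ^ (-(1 + ε))) atTop (nhds 0) := by
  have h1 : Tendsto (fun L : ℝ => L ^ (-ε)) atTop (nhds 0) := tendsto_rpow_neg_atTop hε
  have h2 : Tendsto (fun L : ℝ => L ^ (-(1 + ε))) atTop (nhds 0) :=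
    tendsto_rpow_neg_atTop (by linarith)
  have h3 : Tendsto (fun L : ℝ => 4 * g * C * L ^ (-ε) + 4 * √(g * C * L ^ (-ε)) +
      C * L ^ (-(1 + ε))) atTop (nhds (4 * g * C * 0 + 4 * √(g * C * 0) + C * 0)) :=
    ((h1.const_mul _).add (((Real.continuous_sqrt.tendsto _).comp (h1.const_mul _)).const_mul
      4)).add (h2.const_mul _)
  simp only [mul_zero, Real.sqrt_zero, add_zero] at h3
  refine h3.congr' ?_
  filter_upwards [eventually_gt_atTop 0] with L hL
  have e : L * L ^ (-(1 + ε)) = L ^ (-ε) := by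
    rw [← Real.rpow_one_add' hL.le (by linarith)]
    congr 1
    ring
  have e1 : (2 * √(g * L)) ^ 2 * (C * L ^ (-(1 + ε))) = 4 * g * C * L ^ (-ε) := by
    rw [mul_pow, Real.sq_sqrt (by positivity), ← e]
    ring
  have e2 : 2 * (2 * √(g * L)) * √(C * L ^ (-(1 + ε))) = 4 * √(g * C * L ^ (-ε)) := by
    rw [mul_assoc, mul_assoc, ← Real.sqrt_mul (by positivity), ← e]
    ring_nf
  rw [e1, e2]

/-- The Stein–Chen term `b₃` for the infinite-volume DGFF vanishes:
`Σ_{α∈I} E| E[X_α | σ(X_β : β ∈ I∖B_α)] - p_α | → 0` as `n → ∞`. -/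
theorem b3_vanishes
    (d : ℕ) (hd : 3 ≤ d)
    {Ω : Type*} [MeasurableSpace Ω] (P : Measure Ω) [IsProbabilityMeasure P]
    (φ : Zd d → Ω → ℝ) (hφ : IsGaussianField P d (green d) φ)
    (k : ℕ) (hk : 1 ≤ k)
    (lo hi : Fin k → Fin d → ℝ) (hlohi : ∀ j i, lo j i < hi j i)
    (hdisj : Pairwise fun j j' => Disjoint (rect d (lo j) (hi j)) (rect d (lo j') (hi j')))
    (z : ℝ) (R : Fin k → Set EReal) (hR : ∀ j, IsFiniteUnionIocFrom z (R j))
    (ε : ℝ) (hε : 0 < ε) :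
    Tendsto
      (fun n : ℕ =>
        ∑ a ∈ stIdx d n k lo hi,
          ∫ ω,
            |(P[stX d n k lo hi R φ a | stSigma d n k ε lo hi R φ a]) ω
              - (P {ω' | stX d n k lo hi R φ a ω' = 1}).toReal| ∂P)
      atTop (nhds 0) := by
  obtain ⟨C, hC, hgreen⟩ := exists_green_le_rpow d hd
  have hg := one_le_green_zero d hd
  have hg0 : 0 < green d 0 0 := by linarith
  have hN : Tendsto (fun n : ℕ => n ^ d) atTop atTop := tendsto_pow_atTop (by omega)
  have hL := tendsto_log_natCast_atTop.comp hN
  have herr := (tendsto_error_term (C := C) hg0 hε).comp hL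
  have hM : Tendsto (fun L : ℝ => C * L ^ (-(1 + ε))) atTop (nhds 0) := by
    simpa using (tendsto_rpow_neg_atTop (by linarith : 0 < 1 + ε)).const_mul C
  have hinv : Tendsto (fun n : ℕ => ((n ^ d : ℕ) : ℝ)⁻¹) atTop (nhds 0) :=
    tendsto_inv_atTop_nhds_zero_nat.comp hN
  have hbound := (hinv.const_mul (4 * green d 0 0)).add (herr.const_mul (8 * exp (-z)))
  rw [mul_zero, mul_zero, add_zero] at hbound
  refine tendsto_of_tendsto_of_tendsto_of_le_of_le' tendsto_const_nhds hbound
    (.of_forall fun n => Finset.sum_nonneg fun a _ => integral_nonneg fun ω => abs_nonneg _) ?_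
  filter_upwards [hN.eventually (eventually_bN_pos_and_tail_le hg z),
    hN.eventually (eventually_natCast_mul_gaussianReal_abs_le hg),
    hL.eventually_ge_atTop 1, (hM.comp hL).eventually_le_const (show (0 : ℝ) < 1 / 2 by norm_num)]
    with n h1 h2 h3 h4
  simp only [Function.comp_apply] at h3 h4 ⊢
  have hM0 : 0 ≤ C * Real.log ((n ^ d : ℕ) : ℝ) ^ (-(1 + ε)) := by positivity
  refine (sum_integral_abs_condExp_sub_le hd P φ hφ hR ε (div_pos hg0 h1.1) hM0 h4
    (by positivity : 0 ≤ 2 * √(green d 0 0 * Real.log ((n ^ d : ℕ) : ℝ)))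
    (hgreen ε _ hε h3)).trans ?_
  rw [mul_left_comm, mul_add, ← mul_assoc]
  set EA := (2 * √(green d 0 0 * Real.log ((n ^ d : ℕ) : ℝ))) ^ 2 *
    (C * Real.log ((n ^ d : ℕ) : ℝ) ^ (-(1 + ε))) +
      2 * (2 * √(green d 0 0 * Real.log ((n ^ d : ℕ) : ℝ))) *
        √(C * Real.log ((n ^ d : ℕ) : ℝ) ^ (-(1 + ε))) +
          C * Real.log ((n ^ d : ℕ) : ℝ) ^ (-(1 + ε)) with hEA
  have hEA0 : 0 ≤ EA := by positivity
  have h5 := mul_le_mul_of_nonneg_right h1.2 hEA0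
  linarith
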